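/- For every integer k ≥ 2 and every maximal w ∈ Σ whose first digit is k−1, the digit frequency set satisfies DF(w) = {α ∈ Δ : I(α) ≤ w}, where I : Δ → Σ is defined by I(α) = S(Φ(α)) for α ∈ Δ' and I(α) = (k−1)000… for α ∈ F. -/

import Mathlib

open Filter Topology
open scoped Classical

namespace BetaDF

/-- Digit sequences (elements of `Σ = {0,…,k−1}^ℕ` when all entries are `< k`). -/
abbrev Seq : Type := ℕ → ℕ

/-- Lexicographic (strict) order on digit sequences. -/
def seqLt (v w : Seq) : Prop := ∃ r, (∀ s, s < r → v s = w s) ∧ v r < w r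

/-- Lexicographic order on digit sequences. -/
def seqLe (v w : Seq) : Prop := seqLt v w ∨ v = w

/-- The shift map `σ`. -/
def shift (w : Seq) : Seq := fun r => w (r + 1)

/-- Membership in `Σ = {0,…,k−1}^ℕ`. -/
def InSigma (k : ℕ) (w : Seq) : Prop := ∀ r, w r < k

/-- A sequence is maximal if it is `≥` every element of its shift orbit. -/
def IsMaximal (w : Seq) : Prop := ∀ r, seqLe (shift^[r] w) w

/-- Number of occurrences of the digit `i` among the first `r` entries of `w`. -/
def digitCount (w : Seq) (i r : ℕ) : ℕ := ((Finset.range r).filter fun s => w s = i).card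

/-- The ambient Euclidean space `ℝ^k`. -/
abbrev E (k : ℕ) : Type := EuclideanSpace ℝ (Fin k)

/-- The `i`-th coordinate (with junk value `0` for `i ≥ k`). -/
def proj {k : ℕ} (α : E k) (i : ℕ) : ℝ := if h : i < k then α ⟨i, h⟩ else 0

/-- `w` has digit frequency vector `α`. -/
def HasDigitFreq (k : ℕ) (w : Seq) (α : E k) : Prop :=
  ∀ i, i < k →
    Tendsto (fun r => (digitCount w i r : ℝ) / (r : ℝ)) atTop (𝓝 (proj α i))

/-- The standard `(k−1)`-simplex `Δ`. -/
def simplex (k : ℕ) : Set (E k) := {α | (∀ i : Fin k, 0 ≤ α i) ∧ ∑ i, α i = 1}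

/-- The face `F = {α ∈ Δ : α_{k−1} = 0}`. -/
def faceF (k : ℕ) : Set (E k) := {α ∈ simplex k | proj α (k - 1) = 0}

/-- `Δ' = Δ ∖ F`. -/
def simplex' (k : ℕ) : Set (E k) := simplex k \ faceF k

/-- `J(α) = ⌊α₀/α_{k−1}⌋`. -/
noncomputable def Jfun {k : ℕ} (α : E k) : ℕ := ⌊proj α 0 / proj α (k - 1)⌋₊

/-- The map `K_n`. -/
noncomputable def Kmap {k : ℕ} (n : ℕ) (α : E k) : E k :=
  (WithLp.equiv 2 (Fin k → ℝ)).symm fun i =>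
    if (i : ℕ) + 2 < k then proj α ((i : ℕ) + 1) / (1 - proj α 0)
    else if (i : ℕ) + 2 = k then (proj α 0 - n * proj α (k - 1)) / (1 - proj α 0)
    else ((n + 1) * proj α (k - 1) - proj α 0) / (1 - proj α 0)

/-- The continued-fraction map `K : Δ' → Δ'`, `K(α) = K_{J(α)}(α)`. -/
noncomputable def Kstep {k : ℕ} (α : E k) : E k := Kmap (Jfun α) α

/-- The itinerary map `Φ(α)_r = J(K^r(α))`. -/
noncomputable def Phi {k : ℕ} (α : E k) : ℕ → ℕ := fun r => Jfun (Kstep^[r] α)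

/-- The projective embedding `K_n^{-1} : Δ → Δ`. -/
noncomputable def Kinv {k : ℕ} (n : ℕ) (α : E k) : E k :=
  (WithLp.equiv 2 (Fin k → ℝ)).symm fun i =>
    (if (i : ℕ) = 0 then (n + 1) * proj α (k - 2) + n * proj α (k - 1)
      else if (i : ℕ) + 1 = k then proj α (k - 2) + proj α (k - 1)
      else proj α ((i : ℕ) - 1)) /
      ((n + 1) * proj α (k - 2) + n * proj α (k - 1) + 1)

/-- `Υ_{n,r} = K_{n₀}^{-1} ∘ ⋯ ∘ K_{n_r}^{-1}`. -/
noncomputable def Ups {k : ℕ} (n : ℕ → ℕ) : ℕ → E k → E k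
  | 0 => Kinv (n 0)
  | r + 1 => fun α => Ups n r (Kinv (n (r + 1)) α)

/-- `A_{n,r} = Υ_{n,r}(Δ)`. -/
noncomputable def Anr (k : ℕ) (n : ℕ → ℕ) (r : ℕ) : Set (E k) := Ups n r '' simplex k

/-- `F_{n,r} = Υ_{n,r}(F)`. -/
noncomputable def Fnr (k : ℕ) (n : ℕ → ℕ) (r : ℕ) : Set (E k) := Ups n r '' faceF k

/-- Reverse-lexicographic strict order on `ℕ^ℕ`: `a < b` iff `a` exceeds `b`
at the first index where they differ. -/
def revLexLt (a b : ℕ → ℕ) : Prop := ∃ r, (∀ s, s < r → a s = b s) ∧ b r < a r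

/-- The word to which the substitution `Λ_n` sends the digit `i`. -/
def lamWord (k n i : ℕ) : List ℕ :=
  if i + 2 < k then [i + 1]
  else if i + 2 = k then (k - 1) :: List.replicate (n + 1) 0
  else (k - 1) :: List.replicate n 0

/-- The substitution `Λ_n : Σ → Σ`. -/
def lamSub (k n : ℕ) (w : Seq) : Seq := fun m =>
  (((List.range (m + 1)).map fun r => lamWord k n (w r)).flatten).getD m 0

/-- `Λ_{n,r} = Λ_{n₀} ∘ ⋯ ∘ Λ_{n_r}`. -/
def lamChain (k : ℕ) (n : ℕ → ℕ) : ℕ → Seq → Seq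
  | 0 => lamSub k (n 0)
  | r + 1 => fun w => lamChain k n r (lamSub k (n (r + 1)) w)

/-- `Λ_{n₀} ∘ ⋯ ∘ Λ_{n_{R−1}}` for a finite list of indices. -/
def lamList (k : ℕ) : List ℕ → Seq → Seq
  | [], w => w
  | a :: t, w => lamSub k a (lamList k t w)

/-- The constant sequence `(k−1)(k−1)(k−1)…`. -/
def topSeq (k : ℕ) : Seq := fun _ => k - 1

/-- The sequence `(k−1)000…`. -/
def baseSeq (k : ℕ) : Seq := fun m => if m = 0 then k - 1 else 0

/-- `S(n) = lim_{r→∞} Λ_{n,r}((k−1)(k−1)(k−1)…)` (limit in the product topology). -/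
noncomputable def Sseq (k : ℕ) (n : ℕ → ℕ) : Seq :=
  limUnder atTop fun r => lamChain k n r (topSeq k)

/-- The compactified itinerary space `N`: sequences with values in `ℕ∞` such that
all entries from the first `∞` onwards equal `∞`.  Elements with no `∞` entry
correspond to `ℕ^ℕ`; the others are the finite type elements `n₀…n_{R−1}∞`. -/
def NN : Type := {m : ℕ → ℕ∞ // ∀ r, m r = ⊤ → m (r + 1) = ⊤}

/-- Reverse-lexicographic strict order on `N` (`∞` counts as larger than every natural). -/
def nnLt (m n : NN) : Prop := ∃ r, (∀ s, s < r → m.1 s = n.1 s) ∧ n.1 r < m.1 r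

/-- Reverse-lexicographic order on `N`. -/
def nnLe (m n : NN) : Prop := nnLt m n ∨ m = n

/-- The element of `N` determined by an element of `ℕ^ℕ`. -/
def toNN (g : ℕ → ℕ) : NN := ⟨fun r => (g r : ℕ∞), fun r h => absurd h (by simp)⟩

/-- The itinerary `n₀ … n_{R−1} (n_R + 1) 0 0 0 …` (of rational type). -/
def ratSeq (f : ℕ → ℕ) (R : ℕ) : ℕ → ℕ := fun r =>
  if r < R then f r else if r = R then f R + 1 else 0

/-- The finite type element `n₀ … n_{R−1} n_R ∞` of `N`. -/
def finNN (f : ℕ → ℕ) (R : ℕ) : NN :=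
  ⟨fun r => if r ≤ R then (f r : ℕ∞) else ⊤, by
    intro r h
    show (if r + 1 ≤ R then ((f (r + 1) : ℕ∞)) else ⊤) = ⊤
    have h' : (if r ≤ R then ((f r : ℕ∞)) else ⊤) = ⊤ := h
    by_cases h1 : r ≤ R
    · rw [if_pos h1] at h'
      exact absurd h' (by simp)
    · rw [if_neg (by omega : ¬ r + 1 ≤ R)]⟩

/-- The extension of `S` to `N`. -/
noncomputable def SN (k : ℕ) (m : NN) : Seq :=
  if h : ∃ R, m.1 R = ⊤ then
    lamList k ((List.range (Nat.find h)).map fun r => (m.1 r).toNat) (baseSeq k)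
  else Sseq k fun r => (m.1 r).toNat

/-- The metric `d(m,n) = 2^{−X(m,n)}` on `N`, where
`X(m,n) = r + min(m₀+⋯+m_r, n₀+⋯+n_r)` and `r` is the first index where `m,n` differ. -/
noncomputable def dN (m n : NN) : ℝ :=
  if h : m = n then 0
  else
    have hex : ∃ r, m.1 r ≠ n.1 r := by
      by_contra hc
      push_neg at hc
      exact h (Subtype.ext (funext hc))
    (2 : ℝ) ^ (-(((Nat.find hex : ℕ) : ℤ) +
      ((min (∑ s ∈ Finset.range (Nat.find hex + 1), m.1 s)
            (∑ s ∈ Finset.range (Nat.find hex + 1), n.1 s)).toNat : ℤ)))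

/-- The symbolic β-shift `X(w)`. -/
def Xset (k : ℕ) (w : Seq) : Set Seq :=
  {v | InSigma k v ∧ ∀ r, seqLe (shift^[r] v) w}

/-- The digit frequency set `DF(w)` of the symbolic β-shift `X(w)`. -/
def DFw (k : ℕ) (w : Seq) : Set (E k) :=
  {α | α ∈ simplex k ∧ ∃ v ∈ Xset k w, HasDigitFreq k v α}

/-- `DF(n) = DF(S(n))` for `n ∈ ℕ^ℕ`. -/
noncomputable def DFn (k : ℕ) (n : ℕ → ℕ) : Set (E k) := DFw k (Sseq k n)

/-- `DF(n) = DF(S(n))` for `n ∈ N`. -/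
noncomputable def DFN (k : ℕ) (m : NN) : Set (E k) := DFw k (SN k m)

/-- The infimax map `I = S ∘ Φ` on `Δ'`, extended by `I(α) = (k−1)000…` on `F`. -/
noncomputable def Ifun (k : ℕ) (α : E k) : Seq :=
  if α ∈ simplex' k then Sseq k (Phi α) else baseSeq k

/-- The simplex `T_m = {α ∈ Δ : (m+1)α_{k−1} ≤ α₀}`. -/
def Tset (k m : ℕ) : Set (E k) :=
  {α ∈ simplex k | ((m : ℝ) + 1) * proj α (k - 1) ≤ proj α 0}

/-- The standard basis vector `e_i`. -/
noncomputable def evec (k i : ℕ) : E k :=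
  (WithLp.equiv 2 (Fin k → ℝ)).symm fun j => if (j : ℕ) = i then 1 else 0

/-- The rational extreme points
`FE(n) = {Υ_{n,s}(e_{k−2}) : n_{s+t} ≠ 0 for some 1 ≤ t ≤ k−2}`. -/
noncomputable def FEset (k : ℕ) (n : ℕ → ℕ) : Set (E k) :=
  {α | ∃ s, (∃ t, 1 ≤ t ∧ t ≤ k - 2 ∧ n (s + t) ≠ 0) ∧ α = Ups n s (evec k (k - 2))}

/-- The set `E(n)` of non-trivial extreme points of `DF(n)`:
extreme points other than `e₀,…,e_{k−2}`. -/
noncomputable def Eset (k : ℕ) (n : ℕ → ℕ) : Set (E k) :=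
  Set.extremePoints ℝ (DFn k n) \ {α | ∃ i, i ≤ k - 2 ∧ α = evec k i}

/-- The fiber `Φ^{-1}(n) ⊆ Δ'`. -/
noncomputable def PhiFiber (k : ℕ) (n : ℕ → ℕ) : Set (E k) :=
  {α ∈ simplex' k | Phi α = n}

/-- `f_β(x) = βx mod 1`. -/
noncomputable def fbeta (β x : ℝ) : ℝ := Int.fract (β * x)

/-- The digit sequence of the greedy β-expansion of `x`: `d_β(x)_r = ⌊β f_β^r(x)⌋`. -/
noncomputable def dbeta (β : ℝ) (x : ℝ) : Seq := fun r => ⌊β * (fbeta β)^[r] x⌋₊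

/-- The digit frequency set `DF(β)` of β-expansions of points of `[0,1]`. -/
noncomputable def DFbeta (k : ℕ) (β : ℝ) : Set (E k) :=
  {α | α ∈ simplex k ∧ ∃ x ∈ Set.Icc (0 : ℝ) 1, HasDigitFreq k (dbeta β x) α}

/-- The sequence `w_β`: if `d_β(1) = d₁…d_{r−1}d_r000…` with `d_r > 0` then `w_β`
is the infinite repetition of `d₁…d_{r−1}(d_r − 1)`; otherwise `w_β = d_β(1)`. -/
noncomputable def wbeta (β : ℝ) : Seq :=
  if h : ∃ r, dbeta β 1 r ≠ 0 ∧ ∀ s, r < s → dbeta β 1 s = 0 then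
    fun m =>
      if m % (Nat.find h + 1) = Nat.find h then dbeta β 1 (Nat.find h) - 1
      else dbeta β 1 (m % (Nat.find h + 1))
  else dbeta β 1

/-- `DF` extended to `[k−1,k]` by `DF(k−1) = F` and `DF(k) = Δ`. -/
noncomputable def DFext (k : ℕ) (β : ℝ) : Set (E k) :=
  if β ≤ (k : ℝ) - 1 then faceF k
  else if (k : ℝ) ≤ β then simplex k
  else DFbeta k β

/-- The mode-locking interval `I_{n₀…n_R}` determined by the word `f 0, …, f R`. -/
noncomputable def Iint (k : ℕ) (f : ℕ → ℕ) (R : ℕ) : Set ℝ :=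
  {β | (k : ℝ) - 1 < β ∧ β < k ∧
    seqLe (Sseq k (ratSeq f R)) (wbeta β) ∧ seqLe (wbeta β) (SN k (finNN f R))}

/-- The frequency vector of the first `s` digits of `w`. -/
noncomputable def freqVec (k : ℕ) (w : Seq) (s : ℕ) : E k :=
  (WithLp.equiv 2 (Fin k → ℝ)).symm fun i => (digitCount w (i : ℕ) s : ℝ) / (s : ℝ)


theorem shift_iter (w : Seq) (r m : ℕ) : shift^[r] w m = w (r + m) := by
  induction r generalizing w with
  | zero => simp
  | succ r ih =>
    rw [Function.iterate_succ_apply, ih]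
    show w (r + m + 1) = _
    congr 1; omega

theorem seqLe_of_not_lt {v w : Seq} (h : ¬ seqLt w v) : seqLe v w := by
  by_cases he : v = w
  · exact Or.inr he
  · left
    have hex : ∃ r, v r ≠ w r := by
      by_contra hc
      push Not at hc
      exact he (funext hc)
    refine ⟨Nat.find hex, fun s hs => ?_, ?_⟩
    · have := Nat.find_min hex hs
      simpa using this
    · have h1 := Nat.find_spec hex
      by_contra h2
      apply h
      refine ⟨Nat.find hex, fun s hs => ?_, ?_⟩
      · have := Nat.find_min hex hs
        simp at this
        exact this.symm
      · omega

theorem seqLt_of_le_of_lt {u v w : Seq} (h1 : seqLe u v) (h2 : seqLt v w) : ∀ r,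
    (∀ s, s < r → v s = w s) → v r < w r → ∃ q, q ≤ r ∧ (∀ s, s < q → u s = w s) ∧ u q < w q := by
  intro r hr hlt
  rcases h1 with ⟨q, hq, hq'⟩ | rfl
  · rcases lt_or_ge q r with h | h
    · refine ⟨q, h.le, fun s hs => (hq s hs).trans (hr s (hs.trans h)), ?_⟩
      rw [← hr q h]; exact hq'
    · refine ⟨r, le_rfl, fun s hs => (hq s (by omega)).trans (hr s hs), ?_⟩
      rcases h.eq_or_lt with rfl | h
      · omega
      · rw [hq r h]; exact hlt
  · exact ⟨r, le_rfl, hr, hlt⟩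

theorem seqLe_trans {u v w : Seq} (h1 : seqLe u v) (h2 : seqLe v w) : seqLe u w := by
  rcases h2 with h2 | rfl
  · obtain ⟨r, hr, hr'⟩ := h2
    obtain ⟨q, _, a, b⟩ := seqLt_of_le_of_lt h1 ⟨r, hr, hr'⟩ r hr hr'
    exact Or.inl ⟨q, a, b⟩
  · exact h1

/-- Concatenation of a finite word and a sequence. -/
def app (l : List ℕ) (s : Seq) : Seq := fun m => if m < l.length then l.getD m 0 else s (m - l.length)

theorem app_nil (s : Seq) : app [] s = s := by
  funext m; simp [app]

theorem app_cons_zero (a : ℕ) (l : List ℕ) (s : Seq) : app (a :: l) s 0 = a := by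
  simp [app]

theorem app_cons_succ (a : ℕ) (l : List ℕ) (s : Seq) (m : ℕ) :
    app (a :: l) s (m + 1) = app l s m := by
  simp [app]

theorem shift_app_cons (a : ℕ) (l : List ℕ) (s : Seq) : shift (app (a :: l) s) = app l s := by
  funext m; exact app_cons_succ a l s m

theorem app_append (l l' : List ℕ) (s : Seq) : app (l ++ l') s = app l (app l' s) := by
  induction l with
  | nil => simp [app_nil]
  | cons a l ih =>
    funext m
    cases m with
    | zero => simp [app_cons_zero]
    | succ m => simp only [List.cons_append, app_cons_succ, ih]

theorem lamWord_length_pos (k n i : ℕ) : 1 ≤ (lamWord k n i).length := by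
  unfold lamWord; split_ifs <;> simp

theorem flatten_getD_aux (f : ℕ → List ℕ) (hf : ∀ i, 1 ≤ (f i).length) (m R : ℕ) (h : m < R) :
    (((List.range R).map f).flatten).getD m 0 = (((List.range (m + 1)).map f).flatten).getD m 0 := by
  have len : ∀ R, R ≤ (((List.range R).map f).flatten).length := by
    intro R
    induction R with
    | zero => simp
    | succ R ih =>
      rw [List.range_succ, List.map_append, List.flatten_append, List.length_append]
      have := hf R
      simp only [List.map_cons, List.map_nil, List.flatten_cons, List.flatten_nil, List.append_nil]
      omega
  induction R with
  | zero => omega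
  | succ R ih =>
    rcases Nat.lt_succ_iff_lt_or_eq.mp h with h | rfl
    · rw [← ih h, List.range_succ, List.map_append, List.flatten_append,
        List.getD_append _ _ _ _ (lt_of_lt_of_le h (len R))]
    · rfl

theorem lamSub_eq (k n : ℕ) (w : Seq) :
    lamSub k n w = app (lamWord k n (w 0)) (lamSub k n (shift w)) := by
  funext m
  have e : ((List.range (m + 1)).map fun r => lamWord k n (w r)).flatten
      = lamWord k n (w 0) ++ ((List.range m).map fun r => lamWord k n (shift w r)).flatten := by
    rw [List.range_succ_eq_map]
    simp [shift, Function.comp_def]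
  unfold app
  split_ifs with h
  · unfold lamSub
    rw [e, List.getD_append _ _ _ _ h]
  · have hp := lamWord_length_pos k n (w 0)
    unfold lamSub
    rw [e, List.getD_append_right _ _ _ _ (by omega)]
    exact flatten_getD_aux _ (fun i => lamWord_length_pos k n _) _ _ (by omega)

theorem lamSub_zero_pos (k n : ℕ) (hk : 2 ≤ k) (w : Seq) : 1 ≤ lamSub k n w 0 := by
  rw [lamSub_eq]
  unfold lamWord
  split_ifs <;> rw [app_cons_zero] <;> omega

theorem lamSub_zero (k n : ℕ) (hk : 2 ≤ k) (w : Seq) (h : w 0 = k - 1) : lamSub k n w 0 = k - 1 := by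
  rw [lamSub_eq]
  unfold lamWord
  rw [h, if_neg (by omega), if_neg (by omega), app_cons_zero]

theorem lamWord_lt (k n i : ℕ) (hk : 2 ≤ k) : ∀ d ∈ lamWord k n i, d < k := by
  intro d hd
  unfold lamWord at hd
  split_ifs at hd
  · simp at hd; omega
  all_goals
    simp only [List.mem_cons, List.mem_replicate] at hd
    omega

theorem lamSub_lt (k n : ℕ) (hk : 2 ≤ k) (w : Seq) : InSigma k (lamSub k n w) := by
  intro m
  induction m using Nat.strong_induction_on generalizing w with
  | _ m ih =>
    rw [lamSub_eq]
    unfold app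
    split_ifs with h
    · rw [List.getD_eq_getElem _ _ h]
      exact lamWord_lt k n _ hk _ (List.getElem_mem _)
    · have := lamWord_length_pos k n (w 0)
      exact ih _ (by omega) _

/-- word is lexicographically at most the prefix of `s` of the same length. -/
def listLe : List ℕ → Seq → Prop
  | [], _ => True
  | a :: l, s => a < s 0 ∨ (a = s 0 ∧ listLe l (shift s))

theorem listLe_append_app (l y : List ℕ) (s : Seq) (h : listLe y s) : listLe (l ++ y) (app l s) := by
  induction l with
  | nil => simpa [app_nil] using h
  | cons a l ih =>
    right
    exact ⟨(app_cons_zero _ _ _).symm, by rw [shift_app_cons]; exact ih⟩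

theorem listLe_prefix {l y : List ℕ} {s : Seq} (h : listLe (l ++ y) s) : listLe l s := by
  induction l generalizing s with
  | nil => trivial
  | cons a l ih =>
    rcases h with h | ⟨h, h'⟩
    · exact Or.inl h
    · exact Or.inr ⟨h, ih h'⟩

/-- word-level substitution -/
def lamL (k n : ℕ) (y : List ℕ) : List ℕ := y.flatMap (lamWord k n)

theorem listLe_lam (k n : ℕ) (hk : 2 ≤ k) (y : List ℕ) (s : Seq) (hs : InSigma k s)
    (h : listLe y s) : listLe (lamL k n y) (lamSub k n s) := by
  induction y generalizing s with
  | nil => trivial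
  | cons a y ih =>
    rw [lamSub_eq]
    have e : lamL k n (a :: y) = lamWord k n a ++ lamL k n y := by simp [lamL]
    rw [e]
    rcases h with h | ⟨rfl, h⟩
    · have h0 := hs 0
      by_cases h1 : a + 2 < k
      · have : lamWord k n a = [a + 1] := by simp [lamWord, h1]
        rw [this]
        left
        unfold lamWord
        split_ifs <;> rw [app_cons_zero] <;> omega
      · have ha : a + 2 = k := by omega
        have e1 : lamWord k n a = ((k - 1) :: List.replicate n 0) ++ [0] := by
          simp [lamWord, ha, List.replicate_succ']
        have e2 : lamWord k n (s 0) = ((k - 1) :: List.replicate n 0) := by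
          unfold lamWord; rw [if_neg (by omega), if_neg (by omega)]
        rw [e1, e2, List.append_assoc]
        apply listLe_append_app
        left
        exact lamSub_zero_pos k n hk _
    · apply listLe_append_app
      exact ih _ (fun r => hs _) h

/-- suffix-good words -/
def SG (y : List ℕ) (s : Seq) : Prop := ∀ z, z <:+ y → listLe z s

theorem SG_lam (k n : ℕ) (hk : 2 ≤ k) (y : List ℕ) (s : Seq) (hs : InSigma k s) (hs0 : s 0 = k - 1)
    (h : SG y s) : SG (lamL k n y) (lamSub k n s) := by
  induction y with
  | nil =>
    intro z hz
    have : z = [] := by simpa [lamL] using hz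
    subst this; trivial
  | cons a y ih =>
    have e : lamL k n (a :: y) = lamWord k n a ++ lamL k n y := by simp [lamL]
    have ih' := ih (fun z hz => h z (hz.trans (List.suffix_cons _ _)))
    have hfull : listLe (lamL k n (a :: y)) (lamSub k n s) :=
      listLe_lam k n hk _ s hs (h _ List.suffix_rfl)
    have hz : ∀ j, SG (List.replicate j 0 ++ lamL k n y) (lamSub k n s) := by
      intro j
      induction j with
      | zero => simpa using ih'
      | succ j ihj =>
        intro z hz
        rw [List.replicate_succ, List.cons_append, List.suffix_cons_iff] at hz
        rcases hz with rfl | hz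
        · left
          exact lamSub_zero_pos k n hk s
        · exact ihj z hz
    intro z hz'
    have e3 : ∃ b j, lamWord k n a = b :: List.replicate j 0 := by
      unfold lamWord
      split_ifs
      · exact ⟨a + 1, 0, rfl⟩
      · exact ⟨_, _, rfl⟩
      · exact ⟨_, _, rfl⟩
    obtain ⟨b, j, e3⟩ := e3
    have hz2 := hz'
    rw [e, e3, List.cons_append, List.suffix_cons_iff] at hz'
    rcases hz' with h1 | h1
    · rw [h1, ← List.cons_append, ← e3, ← e]; exact hfull
    · exact hz j z h1


/-- agreement on the first `L` entries -/
def agree (L : ℕ) (v w : Seq) : Prop := ∀ j, j < L → v j = w j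

theorem agree_app (L : ℕ) (l : List ℕ) {s t : Seq} (h : agree L s t) :
    agree (l.length + L) (app l s) (app l t) := by
  intro j hj
  unfold app
  split_ifs with h1
  · rfl
  · exact h _ (by omega)

theorem agree_lam (k n L : ℕ) {v w : Seq} (h : agree L v w) :
    agree L (lamSub k n v) (lamSub k n w) := by
  induction L generalizing v w with
  | zero => intro j hj; omega
  | succ L ih =>
    rw [lamSub_eq k n v, lamSub_eq k n w, h 0 (by omega)]
    have h1 : agree L (shift v) (shift w) := fun j hj => h (j + 1) (by omega)
    have h2 := agree_app L (lamWord k n (w 0)) (ih h1)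
    have := lamWord_length_pos k n (w 0)
    intro j hj
    exact h2 j (by omega)

theorem agree_lam_succ (k n L : ℕ) (hk : 2 ≤ k) (hn : n ≠ 0) {v w : Seq} (h : agree L v w)
    (hv : v 0 = k - 1) (hw : w 0 = k - 1) :
    agree (L + 1) (lamSub k n v) (lamSub k n w) := by
  cases L with
  | zero =>
    intro j hj
    have : j = 0 := by omega
    subst this
    rw [lamSub_zero k n hk v hv, lamSub_zero k n hk w hw]
  | succ L =>
    rw [lamSub_eq k n v, lamSub_eq k n w, hv, hw]
    have h1 : agree L (shift v) (shift w) := fun j hj => h (j + 1) (by omega)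
    have h2 := agree_app L (lamWord k n (k - 1)) (agree_lam k n L h1)
    have h3 : (lamWord k n (k - 1)).length = n + 1 := by
      unfold lamWord
      rw [if_neg (by omega), if_neg (by omega)]
      simp
    intro j hj
    exact h2 j (by omega)

theorem lamChain_succ' (k : ℕ) (n : ℕ → ℕ) (r : ℕ) (w : Seq) :
    lamChain k n (r + 1) w = lamSub k (n 0) (lamChain k (fun i => n (i + 1)) r w) := by
  induction r generalizing w with
  | zero => rfl
  | succ r ih =>
    show lamChain k n (r + 1) (lamSub k (n (r + 2)) w) = _
    rw [ih]
    rfl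

theorem lamChain_zero (k : ℕ) (hk : 2 ≤ k) (n : ℕ → ℕ) (r : ℕ) : lamChain k n r (topSeq k) 0 = k - 1 := by
  induction r generalizing n with
  | zero => exact lamSub_zero k _ hk _ rfl
  | succ r ih =>
    rw [lamChain_succ']
    exact lamSub_zero k _ hk _ (ih _)

theorem lamSub_top (k : ℕ) (hk : 2 ≤ k) : lamSub k 0 (topSeq k) = topSeq k := by
  funext m
  induction m with
  | zero => exact lamSub_zero k _ hk _ rfl
  | succ m ih =>
    rw [lamSub_eq]
    have : lamWord k 0 (topSeq k 0) = [k - 1] := by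
      unfold lamWord topSeq
      rw [if_neg (by omega), if_neg (by omega)]
      simp
    rw [this, app_cons_succ, app_nil]
    exact ih

theorem lamChain_top (k : ℕ) (hk : 2 ≤ k) (n : ℕ → ℕ) (hn : ∀ i, n i = 0) (r : ℕ) :
    lamChain k n r (topSeq k) = topSeq k := by
  induction r with
  | zero => show lamSub k (n 0) _ = _; rw [hn, lamSub_top k hk]
  | succ r ih =>
    show lamChain k n r (lamSub k (n (r + 1)) _) = _
    rw [hn, lamSub_top k hk, ih]

theorem chain_conv (k : ℕ) (hk : 2 ≤ k) (L : ℕ) : ∀ n : ℕ → ℕ, ∃ R, ∀ r, R ≤ r →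
    agree L (lamChain k n r (topSeq k)) (lamChain k n R (topSeq k)) := by
  induction L with
  | zero => intro n; exact ⟨0, fun r _ j hj => by omega⟩
  | succ L ih =>
    intro n
    by_cases h0 : ∀ i, n i = 0
    · refine ⟨0, fun r _ => ?_⟩
      rw [lamChain_top k hk n h0, lamChain_top k hk n h0]
      intro j _; rfl
    · push Not at h0
      obtain ⟨j, hj⟩ := h0
      induction j generalizing n with
      | zero =>
        obtain ⟨R, hR⟩ := ih (fun i => n (i + 1))
        refine ⟨R + 1, fun r hr => ?_⟩
        obtain ⟨r, rfl⟩ : ∃ r', r = r' + 1 := ⟨r - 1, by omega⟩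
        rw [lamChain_succ', lamChain_succ']
        exact agree_lam_succ k _ L hk hj (hR r (by omega)) (lamChain_zero k hk _ _)
          (lamChain_zero k hk _ _)
      | succ j ihj =>
        obtain ⟨R, hR⟩ := ihj (fun i => n (i + 1)) hj
        refine ⟨R + 1, fun r hr => ?_⟩
        obtain ⟨r, rfl⟩ : ∃ r', r = r' + 1 := ⟨r - 1, by omega⟩
        rw [lamChain_succ', lamChain_succ']
        exact agree_lam k _ _ (hR r (by omega))

theorem Sseq_tendsto (k : ℕ) (hk : 2 ≤ k) (n : ℕ → ℕ) :
    Tendsto (fun r => lamChain k n r (topSeq k)) atTop (𝓝 (Sseq k n)) := by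
  choose R hR using fun L => chain_conv k hk L n
  have : Tendsto (fun r => lamChain k n r (topSeq k)) atTop
      (𝓝 (fun m => lamChain k n (R (m + 1)) (topSeq k) m)) := by
    rw [tendsto_pi_nhds]
    intro m
    refine tendsto_const_nhds.congr' ?_
    filter_upwards [eventually_ge_atTop (R (m + 1))] with r hr
    exact (hR (m + 1) r hr m (by omega)).symm
  unfold Sseq
  rw [this.limUnder_eq]
  exact this

theorem Sseq_agree (k : ℕ) (hk : 2 ≤ k) (n : ℕ → ℕ) (L : ℕ) :
    ∀ᶠ r in atTop, agree L (lamChain k n r (topSeq k)) (Sseq k n) := by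
  have h := Sseq_tendsto k hk n
  rw [tendsto_pi_nhds] at h
  have h2 : ∀ j, ∀ᶠ r in atTop, lamChain k n r (topSeq k) j = Sseq k n j := by
    intro j
    have := h j
    rw [nhds_discrete, tendsto_pure] at this
    exact this
  induction L with
  | zero => exact Eventually.of_forall fun r j hj => by omega
  | succ L ih =>
    filter_upwards [ih, h2 L] with r h3 h4 j hj
    rcases Nat.lt_succ_iff_lt_or_eq.mp hj with h | rfl
    · exact h3 j h
    · exact h4

theorem Sseq_eq (k : ℕ) (hk : 2 ≤ k) (n : ℕ → ℕ) :
    Sseq k n = lamSub k (n 0) (Sseq k (fun i => n (i + 1))) := by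
  funext m
  have h1 := (tendsto_add_atTop_nat 1).eventually (Sseq_agree k hk n (m + 1))
  have h2 := Sseq_agree k hk (fun i => n (i + 1)) (m + 1)
  obtain ⟨r, h1, h2⟩ := (h1.and h2).exists
  rw [← h1 m (by omega), lamChain_succ']
  exact agree_lam k _ _ h2 m (by omega)

theorem Sseq_zero (k : ℕ) (hk : 2 ≤ k) (n : ℕ → ℕ) : Sseq k n 0 = k - 1 := by
  obtain ⟨r, h1⟩ := (Sseq_agree k hk n 1).exists
  rw [← h1 0 (by omega), lamChain_zero k hk]

theorem Sseq_lt (k : ℕ) (hk : 2 ≤ k) (n : ℕ → ℕ) : InSigma k (Sseq k n) := by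
  rw [Sseq_eq k hk]
  exact lamSub_lt k _ hk _

theorem Sseq_top (k : ℕ) (hk : 2 ≤ k) (n : ℕ → ℕ) (hn : ∀ i, n i = 0) : Sseq k n = topSeq k := by
  funext m
  obtain ⟨r, h1⟩ := (Sseq_agree k hk n (m + 1)).exists
  rw [← h1 m (by omega), lamChain_top k hk n hn]


theorem sum_proj {k : ℕ} (α : E k) : ∑ i ∈ Finset.range k, proj α i = ∑ i, α i := by
  rw [Finset.sum_range]
  refine Finset.sum_congr rfl fun i _ => ?_
  simp [proj]

theorem mem_simplex_iff {k : ℕ} (α : E k) : α ∈ simplex k ↔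
    (∀ i, i < k → 0 ≤ proj α i) ∧ ∑ i ∈ Finset.range k, proj α i = 1 := by
  rw [sum_proj]
  unfold simplex
  constructor
  · rintro ⟨h1, h2⟩
    exact ⟨fun i hi => by simpa [proj, hi] using h1 ⟨i, hi⟩, h2⟩
  · rintro ⟨h1, h2⟩
    exact ⟨fun i => by simpa [proj] using h1 i i.2, h2⟩

theorem mem_simplex'_iff {k : ℕ} (hk : 2 ≤ k) (α : E k) : α ∈ simplex' k ↔
    α ∈ simplex k ∧ 0 < proj α (k - 1) := by
  unfold simplex' faceF
  constructor
  · rintro ⟨h1, h2⟩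
    refine ⟨h1, lt_of_le_of_ne (((mem_simplex_iff α).1 h1).1 _ (by omega)) ?_⟩
    intro h
    exact h2 ⟨h1, h.symm⟩
  · rintro ⟨h1, h2⟩
    exact ⟨h1, fun h => h2.ne' h.2⟩

theorem sum_split {k : ℕ} (hk : 2 ≤ k) (f : ℕ → ℝ) : ∑ i ∈ Finset.range k, f i =
    ∑ i ∈ Finset.range (k - 2), f i + f (k - 2) + f (k - 1) := by
  obtain ⟨m, rfl⟩ : ∃ m, k = m + 2 := ⟨k - 2, by omega⟩
  rw [Finset.sum_range_succ, Finset.sum_range_succ]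
  simp

theorem sum_split' {k : ℕ} (hk : 2 ≤ k) (f : ℕ → ℝ) : ∑ i ∈ Finset.range k, f i =
    f 0 + ∑ i ∈ Finset.range (k - 2), f (i + 1) + f (k - 1) := by
  obtain ⟨m, rfl⟩ : ∃ m, k = m + 2 := ⟨k - 2, by omega⟩
  rw [Finset.sum_range_succ, Finset.sum_range_succ']
  simp; ring

theorem proj_le {k : ℕ} (hk : 2 ≤ k) {α : E k} (h : α ∈ simplex k) : proj α 0 + proj α (k - 1) ≤ 1 := by
  obtain ⟨h1, h2⟩ := (mem_simplex_iff α).1 h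
  rw [sum_split' hk] at h2
  have : 0 ≤ ∑ i ∈ Finset.range (k - 2), proj α (i + 1) :=
    Finset.sum_nonneg fun i hi => h1 _ (by simp at hi; omega)
  linarith

theorem proj_le_one {k : ℕ} {α : E k} (h : α ∈ simplex k) (i : ℕ) (hi : i < k) : proj α i ≤ 1 := by
  obtain ⟨h1, h2⟩ := (mem_simplex_iff α).1 h
  rw [← h2]
  exact Finset.single_le_sum (f := fun i => proj α i) (fun j hj => h1 j (by simpa using hj))
    (by simpa using hi)

theorem Kmap_low {k : ℕ} (n : ℕ) (α : E k) (i : ℕ) (hi : i + 2 < k) :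
    proj (Kmap n α) i = proj α (i + 1) / (1 - proj α 0) := by
  have : i < k := by omega
  simp [proj, Kmap, this, hi]

theorem Kmap_mid {k : ℕ} (hk : 2 ≤ k) (n : ℕ) (α : E k) :
    proj (Kmap n α) (k - 2) = (proj α 0 - n * proj α (k - 1)) / (1 - proj α 0) := by
  have h1 : k - 2 < k := by omega
  have h2 : ¬ (k - 2 + 2 < k) := by omega
  have h3 : k - 2 + 2 = k := by omega
  conv_lhs => unfold proj
  rw [dif_pos h1]
  simp only [Kmap, WithLp.equiv_symm_apply]
  rw [if_neg h2, if_pos h3]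

theorem Kmap_top {k : ℕ} (hk : 2 ≤ k) (n : ℕ) (α : E k) :
    proj (Kmap n α) (k - 1) = ((n + 1) * proj α (k - 1) - proj α 0) / (1 - proj α 0) := by
  have h1 : k - 1 < k := by omega
  have h2 : ¬ (k - 1 + 2 < k) := by omega
  have h3 : ¬ (k - 1 + 2 = k) := by omega
  conv_lhs => unfold proj
  rw [dif_pos h1]
  simp only [Kmap, WithLp.equiv_symm_apply]
  rw [if_neg h2, if_neg h3]

theorem J_bounds {k : ℕ} (hk : 2 ≤ k) {α : E k} (h : α ∈ simplex' k) :
    (Jfun α : ℝ) * proj α (k - 1) ≤ proj α 0 ∧ proj α 0 < (Jfun α + 1) * proj α (k - 1) := by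
  obtain ⟨h1, h2⟩ := (mem_simplex'_iff hk α).1 h
  have h0 := ((mem_simplex_iff α).1 h1).1 0 (by omega)
  have hn : 0 ≤ proj α 0 / proj α (k - 1) := by positivity
  constructor
  · have := Nat.floor_le hn
    rw [le_div_iff₀ h2] at this
    exact this
  · have := Nat.lt_floor_add_one (proj α 0 / proj α (k - 1))
    rw [div_lt_iff₀ h2] at this
    exact this

theorem one_sub_pos {k : ℕ} (hk : 2 ≤ k) {α : E k} (h : α ∈ simplex' k) : 0 < 1 - proj α 0 := by
  obtain ⟨h1, h2⟩ := (mem_simplex'_iff hk α).1 h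
  have := proj_le hk h1
  linarith

theorem Kstep_mem {k : ℕ} (hk : 2 ≤ k) {α : E k} (h : α ∈ simplex' k) : Kstep α ∈ simplex' k := by
  obtain ⟨h1, h2⟩ := (mem_simplex'_iff hk α).1 h
  obtain ⟨h3, h4⟩ := (mem_simplex_iff α).1 h1
  obtain ⟨h5, h6⟩ := J_bounds hk h
  have hp := one_sub_pos hk h
  rw [mem_simplex'_iff hk, mem_simplex_iff]
  unfold Kstep
  refine ⟨⟨fun i hi => ?_, ?_⟩, ?_⟩
  · rcases Nat.lt_trichotomy (i + 2) k with h | h | h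
    · rw [Kmap_low _ _ _ h]
      have := h3 (i + 1) (by omega)
      positivity
    · have : i = k - 2 := by omega
      subst this
      rw [Kmap_mid hk]
      apply div_nonneg _ hp.le
      linarith
    · have : i = k - 1 := by omega
      subst this
      rw [Kmap_top hk]
      apply div_nonneg _ hp.le
      linarith
  · rw [sum_split hk, Kmap_mid hk, Kmap_top hk]
    have : ∑ i ∈ Finset.range (k - 2), proj (Kmap (Jfun α) α) i
        = (∑ i ∈ Finset.range (k - 2), proj α (i + 1)) / (1 - proj α 0) := by
      rw [Finset.sum_div]
      refine Finset.sum_congr rfl fun i hi => ?_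
      simp at hi
      exact Kmap_low _ _ _ (by omega)
    rw [this]
    rw [sum_split' hk] at h4
    rw [← add_div, ← add_div, div_eq_one_iff_eq hp.ne']
    linarith
  · rw [Kmap_top hk]
    apply div_pos _ hp
    linarith

theorem Kiter_mem {k : ℕ} (hk : 2 ≤ k) {α : E k} (h : α ∈ simplex' k) (r : ℕ) :
    Kstep^[r] α ∈ simplex' k := by
  induction r with
  | zero => exact h
  | succ r ih => rw [Function.iterate_succ_apply']; exact Kstep_mem hk ih

theorem Phi_Kstep {k : ℕ} (α : E k) : Phi (Kstep α) = fun i => Phi α (i + 1) := by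
  funext i
  simp only [Phi, Function.iterate_succ_apply]

theorem Phi_Kiter {k : ℕ} (α : E k) (r : ℕ) : Phi (Kstep^[r] α) = fun i => Phi α (r + i) := by
  funext i
  simp only [Phi]
  rw [← Function.iterate_add_apply, add_comm]

theorem I_eq {k : ℕ} (hk : 2 ≤ k) (α : E k) :
    Sseq k (Phi α) = lamSub k (Jfun α) (Sseq k (Phi (Kstep α))) := by
  rw [Sseq_eq k hk, Phi_Kstep]; rfl

theorem zero_itin_aux {k : ℕ} (hk : 2 ≤ k) (N : ℕ) : ∀ α : E k, α ∈ simplex' k → (∀ r, Phi α r = 0) →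
    ∀ i, i + 1 < k → N * proj α i ≤ proj α (k - 1) := by
  induction N with
  | zero =>
    intro α h _ i hi
    have := ((mem_simplex'_iff hk α).1 h).2
    simp; linarith
  | succ N ih =>
    intro α h hz i hi
    induction i generalizing α with
    | zero =>
      have hp := one_sub_pos hk h
      have hJ : Jfun α = 0 := hz 0
      have h1 := ih (Kstep α) (Kstep_mem hk h) (by rw [Phi_Kstep]; exact fun r => hz _) (k - 2) (by omega)
      unfold Kstep at h1
      rw [Kmap_mid hk, Kmap_top hk, hJ, ← mul_div_assoc, div_le_div_iff_of_pos_right hp] at h1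
      push_cast at h1 ⊢
      linarith
    | succ i ihi =>
      have hp := one_sub_pos hk h
      have hJ : Jfun α = 0 := hz 0
      have h0 := ((mem_simplex_iff α).1 ((mem_simplex'_iff hk α).1 h).1).1 0 (by omega)
      have h1 := ihi (Kstep α) (Kstep_mem hk h) (by rw [Phi_Kstep]; exact fun r => hz _) (by omega)
      unfold Kstep at h1
      rw [Kmap_low _ _ _ (by omega), Kmap_top hk, hJ, ← mul_div_assoc, div_le_div_iff_of_pos_right hp] at h1
      push_cast at h1 ⊢
      linarith

theorem zero_itin {k : ℕ} (hk : 2 ≤ k) (α : E k) (h : α ∈ simplex' k) (hz : ∀ r, Phi α r = 0) :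
    (∀ i, i + 1 < k → proj α i = 0) ∧ proj α (k - 1) = 1 := by
  have h1 := ((mem_simplex'_iff hk α).1 h).1
  obtain ⟨h3, h4⟩ := (mem_simplex_iff α).1 h1
  have a : ∀ i, i + 1 < k → proj α i = 0 := by
    intro i hi
    have h0 := h3 i (by omega)
    by_contra hne
    have hpos : 0 < proj α i := lt_of_le_of_ne h0 (Ne.symm hne)
    obtain ⟨N, hN⟩ := exists_nat_gt (proj α (k - 1) / proj α i)
    have := zero_itin_aux hk N α h hz i hi
    rw [div_lt_iff₀ hpos] at hN
    linarith
  refine ⟨a, ?_⟩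
  rw [sum_split hk, a _ (by omega), Finset.sum_eq_zero] at h4
  · linarith
  · intro i hi
    simp at hi
    exact a i (by omega)


/-- strict lexicographic comparison decided before position `L` -/
def ltBy (L : ℕ) (v s : Seq) : Prop := ∃ r, r < L ∧ (∀ j, j < r → v j = s j) ∧ v r < s r

theorem ltBy_mono {L M : ℕ} (h : L ≤ M) {v s : Seq} (hl : ltBy L v s) : ltBy M v s := by
  obtain ⟨r, h1, h2⟩ := hl
  exact ⟨r, by omega, h2⟩

theorem ltBy_pos {L : ℕ} {v s : Seq} (hl : ltBy L v s) : 1 ≤ L := by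
  obtain ⟨r, h1, h2⟩ := hl
  omega

theorem ltBy_zero {L : ℕ} {v s : Seq} (hl : ltBy L v s) : v 0 ≤ s 0 := by
  obtain ⟨r, h1, h2, h3⟩ := hl
  cases r with
  | zero => exact h3.le
  | succ r => exact (h2 0 (by omega)).le

theorem ltBy_cons {L : ℕ} {v s : Seq} (h0 : v 0 = s 0) (h : ltBy L (shift v) (shift s)) :
    ltBy (L + 1) v s := by
  obtain ⟨r, h1, h2, h3⟩ := h
  refine ⟨r + 1, by omega, fun j hj => ?_, h3⟩
  cases j with
  | zero => exact h0
  | succ j => exact h2 j (by omega)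

theorem ltBy_app {L : ℕ} (l : List ℕ) {v s : Seq} (h : ltBy L (app l v) (app l s)) :
    ltBy (L - l.length) v s := by
  obtain ⟨r, h1, h2, h3⟩ := h
  have hr : l.length ≤ r := by
    by_contra hc
    unfold app at h3
    rw [if_pos (by omega), if_pos (by omega)] at h3
    omega
  refine ⟨r - l.length, by omega, fun j hj => ?_, ?_⟩
  · have := h2 (j + l.length) (by omega)
    unfold app at this
    rw [if_neg (by omega), if_neg (by omega)] at this
    simpa using this
  · unfold app at h3
    rw [if_neg (by omega), if_neg (by omega)] at h3
    exact h3

theorem shift_iter_succ (w : Seq) (t : ℕ) : shift (shift^[t] w) = shift^[t + 1] w := by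
  rw [Function.iterate_succ_apply']

/-- token data -/
structure Tok (k n : ℕ) (v u : Seq) (p d z c : ℕ → ℕ) : Prop where
  tok : ∀ t, shift^[p t] v = app (d t :: List.replicate (z t) 0) (shift^[p (t + 1)] v)
  nz : ∀ t, 1 ≤ d t
  lt : ∀ t, d t < k
  first : ∀ t, v (p t) = d t
  low : ∀ t, d t + 1 < k → c t = c (t + 1) + z t ∧ u t + 1 = d t
  high : ∀ t, d t + 1 = k → (z t = n ∧ c (t + 1) = 0 ∧ c t = 0 ∧ u t + 1 = k) ∨
    (n ≤ z t ∧ u t + 2 = k ∧ c t + n + 1 = c (t + 1) + z t)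

theorem tok_first {k n : ℕ} {v u : Seq} {p d z c : ℕ → ℕ} (T : Tok k n v u p d z c) (t : ℕ) :
    1 ≤ (shift^[p t] v) 0 := by
  rw [shift_iter]; simp only [add_zero]; rw [T.first]; exact T.nz t

theorem word_high {k n : ℕ} {a : ℕ} (hk : 2 ≤ k) (h : a + 1 = k) :
    lamWord k n a = a :: List.replicate n 0 := by
  unfold lamWord
  rw [if_neg (by omega), if_neg (by omega)]
  congr 1; omega

theorem word_mid {k n : ℕ} {a : ℕ} (h : a + 2 = k) :
    lamWord k n a = (a + 1) :: List.replicate (n + 1) 0 := by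
  unfold lamWord
  rw [if_neg (by omega), if_pos (by omega)]
  congr 1; omega

theorem word_low {k n : ℕ} {a : ℕ} (h : a + 2 < k) : lamWord k n a = [a + 1] := by
  unfold lamWord
  rw [if_pos (by omega)]

theorem tok_claim {k n : ℕ} (hk : 2 ≤ k) {v u : Seq} {p d z c : ℕ → ℕ} (T : Tok k n v u p d z c) (L : ℕ) :
    ∀ t s, InSigma k s → c t = 0 → ltBy L (shift^[p t] v) (lamSub k n s) → ltBy L (shift^[t] u) s := by
  induction L using Nat.strong_induction_on with
  | _ L ih =>
    intro t s hs hc h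
    have hL := ltBy_pos h
    have hu0 : (shift^[t] u) 0 = u t := by rw [shift_iter]; rfl
    -- the continuation
    have cont : ∀ l : List ℕ, 1 ≤ l.length → shift^[p t] v = app l (shift^[p (t + 1)] v) →
        lamWord k n (s 0) = l → u t = s 0 → c (t + 1) = 0 → ltBy L (shift^[t] u) s := by
      intro l hl e1 e2 e3 e4
      rw [e1, lamSub_eq, e2] at h
      have h1 := ltBy_app l h
      have h2 := ih (L - l.length) (by omega) (t + 1) (shift s) (fun r => hs _) e4 h1
      rw [← shift_iter_succ] at h2
      exact ltBy_mono (by omega) (ltBy_cons (hu0.trans e3) h2)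
    rcases lt_trichotomy (u t) (s 0) with h1 | h1 | h1
    · exact ⟨0, by omega, fun j hj => by omega, by rw [hu0]; exact h1⟩
    · have hd := T.lt t
      rcases Nat.lt_or_ge (d t + 1) k with h2 | h2
      · obtain ⟨h3, h4⟩ := T.low t h2
        have hz : z t = 0 := by omega
        refine cont [d t] (by simp) ?_ ?_ h1 (by omega)
        · have := T.tok t
          rw [hz] at this
          simpa using this
        · rw [word_low (by omega), ← h1, h4]
      · have h2 : d t + 1 = k := by omega
        rcases T.high t h2 with ⟨h3, h4, h5, h6⟩ | ⟨h3, h4, h5⟩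
        · refine cont (d t :: List.replicate n 0) (by simp) (h3 ▸ T.tok t) ?_ h1 h4
          rw [word_high hk (by omega)]
          congr 1; omega
        · rcases Nat.eq_or_lt_of_le h3 with h6 | h6
          · exfalso
            have e := T.tok t
            rw [← h6] at e
            rw [e, lamSub_eq, word_mid (by omega)] at h
            have e5 : s 0 + 1 = d t := by omega
            rw [e5, List.replicate_succ', ← List.cons_append, app_append] at h
            have h7 := ltBy_zero (ltBy_app _ h)
            have h8 := tok_first T (t + 1)
            rw [app_cons_zero] at h7
            omega
          · refine cont (d t :: List.replicate (n + 1) 0) (by simp) ?_ ?_ h1 (by omega)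
            · have : z t = n + 1 := by omega
              exact this ▸ T.tok t
            · rw [word_mid (by omega)]
              congr 1; omega
    · exfalso
      have h9 := ltBy_zero h
      rw [shift_iter] at h9
      simp only [add_zero] at h9
      rw [T.first, lamSub_eq] at h9
      have hd := T.lt t
      rcases Nat.lt_or_ge (d t + 1) k with h2 | h2
      · obtain ⟨h3, h4⟩ := T.low t h2
        rw [word_low (by omega), app_cons_zero] at h9
        omega
      · have h2 : d t + 1 = k := by omega
        by_cases hlow : s 0 + 2 < k
        · rw [word_low (by omega), app_cons_zero] at h9
          omega
        · rcases T.high t h2 with ⟨h3, h4, h5, h6⟩ | ⟨h3, h4, h5⟩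
          · have e := T.tok t
            rw [h3] at e
            rw [e, lamSub_eq, word_mid (by omega)] at h
            have e5 : s 0 + 1 = d t := by omega
            rw [e5, List.replicate_succ', ← List.cons_append, app_append] at h
            have h7 := ltBy_zero (ltBy_app _ h)
            have h8 := tok_first T (t + 1)
            rw [app_cons_zero] at h7
            omega
          · omega

theorem tok_claim2 {k n : ℕ} (hk : 2 ≤ k) {v u : Seq} {p d z c : ℕ → ℕ} (T : Tok k n v u p d z c) (L : ℕ)
    (t : ℕ) (s : Seq) (hs : InSigma k s) (hs0 : s 0 = k - 1) (hut : u t + 1 = k)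
    (h : ltBy L (shift^[p t] v) (lamSub k n s)) : ltBy (L - n) (shift^[t] u) s := by
  have hu0 : (shift^[t] u) 0 = u t := by rw [shift_iter]; rfl
  have hd := T.lt t
  have h2 : d t + 1 = k := by
    by_contra hne
    have := (T.low t (by omega)).2
    omega
  rcases T.high t h2 with ⟨h3, h4, h5, h6⟩ | ⟨h3, h4, h5⟩
  · have e := T.tok t
    rw [h3] at e
    have : s 0 = d t := by omega
    rw [e, lamSub_eq, word_high hk (by omega), this] at h
    have h7 := ltBy_app _ h
    have h8 := ltBy_pos h7
    have h9 := tok_claim hk T _ (t + 1) (shift s) (fun r => hs _) h4 h7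
    rw [← shift_iter_succ] at h9
    refine ltBy_mono ?_ (ltBy_cons (hu0.trans (by omega)) h9)
    simp at h8 ⊢
    omega
  · omega

theorem dc_zero (v : Seq) (i : ℕ) : digitCount v i 0 = 0 := by simp [digitCount]

theorem dc_succ (v : Seq) (i r : ℕ) : digitCount v i (r + 1) = digitCount v i r + if v r = i then 1 else 0 := by
  unfold digitCount
  rw [Finset.range_add_one, Finset.filter_insert]
  split_ifs with h
  · rw [Finset.card_insert_of_notMem (by simp)]
  · rfl

theorem dc_add (v : Seq) (i r m : ℕ) : digitCount v i (r + m) = digitCount v i r + digitCount (shift^[r] v) i m := by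
  induction m with
  | zero => simp [dc_zero]
  | succ m ih => rw [← add_assoc, dc_succ, dc_succ, ih, shift_iter, add_assoc]

theorem dc_app (l : List ℕ) (s : Seq) (i : ℕ) : digitCount (app l s) i l.length = l.count i := by
  induction l with
  | nil => simp [dc_zero]
  | cons a l ih =>
    have : (a :: l).length = 1 + l.length := by simp [add_comm]
    rw [this, dc_add, dc_succ, dc_zero, app_cons_zero]
    have : shift^[1] (app (a :: l) s) = app l s := shift_app_cons a l s
    rw [this, ih, List.count_cons]
    simp [add_comm]

theorem exists_tail (v : Seq) (h : ∀ N, ∃ s, N ≤ s ∧ v s ≠ 0) (N : ℕ) : ∃ z,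
    shift^[N] v = app (v N :: List.replicate z 0) (shift^[N + z + 1] v) ∧ v (N + z + 1) ≠ 0 := by
  have hex : ∃ z, v (N + z + 1) ≠ 0 := by
    obtain ⟨s, h1, h2⟩ := h (N + 1)
    exact ⟨s - N - 1, by rwa [show N + (s - N - 1) + 1 = s by omega]⟩
  refine ⟨Nat.find hex, ?_, Nat.find_spec hex⟩
  funext m
  rw [shift_iter]
  cases m with
  | zero => rw [app_cons_zero]; rfl
  | succ m =>
    rw [app_cons_succ]
    unfold app
    rw [List.length_replicate]
    split_ifs with h1
    · rw [List.getD_eq_getElem _ _ (by simpa using h1), List.getElem_replicate]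
      have := Nat.find_min hex h1
      simp only [ne_eq, not_not] at this
      exact this
    · rw [shift_iter]; congr 1; omega

theorem exists_sup (A : ℕ → ℤ) (δ : ℝ) (hδ : δ < 0)
    (h : Tendsto (fun t => (A t : ℝ) / (t : ℝ)) atTop (𝓝 δ)) :
    ∃ G : ℕ → ℤ, (∀ t, G t = max (A t) (G (t + 1))) ∧
      Tendsto (fun t => (G t : ℝ) / (t : ℝ)) atTop (𝓝 δ) := by
  have key : ∀ ε, 0 < ε → ∃ T, 1 ≤ T ∧ ∀ t, T ≤ t → (A t : ℝ) ≤ (δ + ε) * t := by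
    intro ε hε
    have := (h.eventually (gt_mem_nhds (show δ < δ + ε by linarith))).and (eventually_ge_atTop 1)
    obtain ⟨T, hT⟩ := eventually_atTop.1 this
    refine ⟨max T 1, le_max_right _ _, fun t ht => ?_⟩
    obtain ⟨h1, h2⟩ := hT t (le_trans (le_max_left _ _) ht)
    have : (0 : ℝ) < t := by exact_mod_cast h2
    rw [div_lt_iff₀ this] at h1
    exact h1.le
  have bdd : ∀ t, ∃ B : ℤ, ∀ m, A (t + m) ≤ B := by
    intro t
    obtain ⟨T, hT1, hT⟩ := key (-δ) (by linarith)
    refine ⟨max 0 (∑ s ∈ Finset.range T, |A s|), fun m => ?_⟩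
    rcases Nat.lt_or_ge (t + m) T with h1 | h1
    · refine le_trans ?_ (le_max_right _ _)
      refine (le_abs_self _).trans ?_
      exact Finset.single_le_sum (f := fun s => |A s|) (fun _ _ => abs_nonneg _) (by simpa using h1)
    · refine le_trans ?_ (le_max_left _ _)
      have := hT _ h1
      simp only [add_neg_cancel, zero_mul] at this
      exact_mod_cast this
  have ex : ∀ t, ∃ g : ℤ, (∃ m, A (t + m) = g) ∧ ∀ m, A (t + m) ≤ g := by
    intro t
    obtain ⟨B, hB⟩ := bdd t
    obtain ⟨g, h1, h2⟩ := Int.exists_greatest_of_bdd (P := fun g => ∃ m, A (t + m) = g)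
      ⟨B, by rintro _ ⟨m, rfl⟩; exact hB m⟩ ⟨_, 0, rfl⟩
    exact ⟨g, h1, fun m => h2 _ ⟨m, rfl⟩⟩
  choose G hG1 hG2 using ex
  refine ⟨G, fun t => ?_, ?_⟩
  · apply le_antisymm
    · obtain ⟨m, hm⟩ := hG1 t
      cases m with
      | zero => rw [← hm]; exact le_max_left _ _
      | succ m =>
        rw [← hm]
        refine le_trans ?_ (le_max_right _ _)
        have := hG2 (t + 1) m
        rwa [show t + 1 + m = t + (m + 1) by omega] at this
    · apply max_le
      · exact hG2 t 0
      · obtain ⟨m, hm⟩ := hG1 (t + 1)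
        rw [← hm, show t + 1 + m = t + (m + 1) by omega]
        exact hG2 t _
  · rw [tendsto_order]
    constructor
    · intro a ha
      filter_upwards [h.eventually (lt_mem_nhds ha)] with t ht
      refine ht.trans_le ?_
      have : A t ≤ G t := hG2 t 0
      have : (A t : ℝ) ≤ G t := by exact_mod_cast this
      gcongr
    · intro a ha
      set ε := min ((a - δ) / 2) (-δ) with hε
      have hε0 : 0 < ε := lt_min (by linarith) (by linarith)
      have hε1 : ε ≤ (a - δ) / 2 := min_le_left _ _
      have hε2 : ε ≤ -δ := min_le_right _ _
      obtain ⟨T, hT1, hT⟩ := key ε hε0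
      filter_upwards [eventually_ge_atTop T] with t ht
      have ht0 : (0 : ℝ) < t := by exact_mod_cast (by omega : 0 < t)
      rw [div_lt_iff₀ ht0]
      obtain ⟨m, hm⟩ := hG1 t
      rw [← hm]
      have h3 := hT (t + m) (by omega)
      have h4 : (δ + ε) * ((t + m : ℕ) : ℝ) ≤ (δ + ε) * t := by
        apply mul_le_mul_of_nonpos_left _ (by linarith)
        push_cast
        have : (0 : ℝ) ≤ m := by positivity
        linarith
      have h5 : (δ + ε) * t < a * t := by
        apply mul_lt_mul_of_pos_right _ ht0
        linarith
      linarith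


theorem freq_pos_exists {k : ℕ} {α : E k} {v : Seq} (hf : HasDigitFreq k v α) {i : ℕ} (hi : i < k)
    (hpos : 0 < proj α i) (N : ℕ) : ∃ s, N ≤ s ∧ v s = i := by
  by_contra hc
  push Not at hc
  have hb : ∀ r, N ≤ r → digitCount v i r = digitCount v i N := by
    intro r hr
    induction r, hr using Nat.le_induction with
    | base => rfl
    | succ r hr ih => rw [dc_succ, if_neg (hc r hr), ih]; rfl
  have h1 : Tendsto (fun r : ℕ => (digitCount v i N : ℝ) / (r : ℝ)) atTop (𝓝 0) :=
    tendsto_const_div_atTop_nhds_zero_nat _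
  have h2 := (hf i hi).congr' (by
    filter_upwards [eventually_ge_atTop N] with r hr
    rw [hb r hr])
  have := tendsto_nhds_unique h1 h2
  linarith

theorem step {k : ℕ} (hk : 2 ≤ k) {α : E k} (hα : α ∈ simplex' k) {v : Seq} (hv : InSigma k v)
    (hf : HasDigitFreq k v α) (L : ℕ) (hL : ∀ q, ltBy L (shift^[q] v) (Sseq k (Phi α))) :
    ∃ u, InSigma k u ∧ HasDigitFreq k u (Kstep α) ∧
      (∀ t, ltBy L (shift^[t] u) (Sseq k (Phi (Kstep α)))) ∧
      (Jfun α ≠ 0 → ∀ t, ltBy (L - 1) (shift^[t] u) (Sseq k (Phi (Kstep α)))) := by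
  obtain ⟨hα1, hα2⟩ := (mem_simplex'_iff hk α).1 hα
  obtain ⟨hJ1, hJ2⟩ := J_bounds hk hα
  have hp1 := one_sub_pos hk hα
  set n := Jfun α with hn
  set s := Sseq k (Phi (Kstep α)) with hs
  have hs0 : s 0 = k - 1 := Sseq_zero k hk _
  have hsk : InSigma k s := Sseq_lt k hk _
  have hI : Sseq k (Phi α) = lamSub k n s := I_eq hk α
  rw [hI] at hL
  -- tokens
  have hinf : ∀ N, ∃ r, N ≤ r ∧ v r ≠ 0 := by
    intro N
    obtain ⟨r, h1, h2⟩ := freq_pos_exists hf (by omega) hα2 N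
    exact ⟨r, h1, by omega⟩
  choose zf hzf1 hzf2 using exists_tail v hinf
  obtain ⟨p0, _, hp0⟩ := hinf 0
  obtain ⟨p, hp00, hps⟩ : ∃ p : ℕ → ℕ, p 0 = p0 ∧ ∀ t, p (t + 1) = p t + zf (p t) + 1 :=
    ⟨fun t => Nat.rec p0 (fun _ q => q + zf q + 1) t, rfl, fun t => rfl⟩
  obtain ⟨d, hd⟩ : ∃ d : ℕ → ℕ, ∀ t, d t = v (p t) := ⟨_, fun t => rfl⟩
  obtain ⟨z, hz⟩ : ∃ z : ℕ → ℕ, ∀ t, z t = zf (p t) := ⟨_, fun t => rfl⟩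
  have hnz : ∀ t, 1 ≤ d t := by
    intro t
    rw [hd]
    cases t with
    | zero => rw [hp00]; omega
    | succ t => rw [hps]; have := hzf2 (p t); omega
  have htok : ∀ t, shift^[p t] v = app (d t :: List.replicate (z t) 0) (shift^[p (t + 1)] v) := by
    intro t
    rw [hd, hz, hps]
    exact hzf1 (p t)
  have hstep : ∀ t, p (t + 1) = p t + (d t :: List.replicate (z t) 0).length := by
    intro t; rw [hps, hz]; simp; omega
  have hcnt : ∀ t i, digitCount v i (p (t + 1)) = digitCount v i (p t) +
      (d t :: List.replicate (z t) 0).count i := by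
    intro t i
    rw [hstep, dc_add]
    rw [htok t, dc_app]
  have hcnt0 : ∀ t, digitCount v 0 (p (t + 1)) = digitCount v 0 (p t) + z t := by
    intro t
    rw [hcnt, List.count_cons]
    have := hnz t
    simp; omega
  have hcnt1 : ∀ t i, 1 ≤ i → digitCount v i (p (t + 1)) = digitCount v i (p t) +
      if d t = i then 1 else 0 := by
    intro t i hi
    rw [hcnt, List.count_cons, List.count_replicate, if_neg (by simp; omega)]
    simp
  have hzn : ∀ t, d t + 1 = k → n ≤ z t := by
    intro t hdt
    by_contra hlt
    have h := hL (p t)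
    rw [htok, lamSub_eq, word_high hk (by omega)] at h
    have e1 : s 0 = d t := by omega
    obtain ⟨m, hm⟩ : ∃ m, n = z t + (m + 1) := ⟨n - z t - 1, by omega⟩
    rw [e1, hm, List.replicate_add, ← List.cons_append, app_append] at h
    have h7 := ltBy_zero (ltBy_app _ h)
    rw [List.replicate_succ, app_cons_zero, shift_iter] at h7
    have := hnz (t + 1)
    rw [hd] at this
    simp at h7
    omega
  -- rates
  have hpt : ∀ t, p t + digitCount v 0 (p 0) = t + digitCount v 0 (p t) + p 0 := by
    intro t
    induction t with
    | zero => omega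
    | succ t ih => rw [hcnt0, hps, ← hz]; omega
  have hple : ∀ t, t ≤ p t := by
    intro t
    induction t with
    | zero => omega
    | succ t ih => rw [hps]; omega
  have hpinf : Tendsto p atTop atTop := tendsto_atTop_mono hple tendsto_id
  have hpinfR : Tendsto (fun t => (p t : ℝ)) atTop atTop := tendsto_natCast_atTop_atTop.comp hpinf
  have hrate : ∀ i, i < k → Tendsto (fun t => (digitCount v i (p t) : ℝ) / (p t : ℝ)) atTop (𝓝 (proj α i)) :=
    fun i hi => (hf i hi).comp hpinf
  have htp : Tendsto (fun t : ℕ => (t : ℝ) / (p t : ℝ)) atTop (𝓝 (1 - proj α 0)) := by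
    have h1 : Tendsto (fun t => ((digitCount v 0 (p 0) : ℝ) - p 0) / (p t : ℝ)) atTop (𝓝 0) :=
      tendsto_const_nhds.div_atTop hpinfR
    have h2 := ((tendsto_const_nhds (x := (1 : ℝ))).sub (hrate 0 (by omega))).add h1
    rw [add_zero] at h2
    refine h2.congr' ?_
    filter_upwards [eventually_ge_atTop 1] with t ht
    have hpp : (0 : ℝ) < p t := by
      have := hple t
      exact_mod_cast (by omega : 0 < p t)
    have h3 : (p t : ℝ) + digitCount v 0 (p 0) = t + digitCount v 0 (p t) + p 0 := by exact_mod_cast hpt t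
    field_simp
    linarith
  have hrate2 : ∀ i, i < k → Tendsto (fun t => (digitCount v i (p t) : ℝ) / (t : ℝ)) atTop
      (𝓝 (proj α i / (1 - proj α 0))) := by
    intro i hi
    refine ((hrate i hi).div htp hp1.ne').congr' ?_
    filter_upwards [eventually_ge_atTop 1] with t ht
    have hpp : (0 : ℝ) < p t := by
      have := hple t
      exact_mod_cast (by omega : 0 < p t)
    have htt : (0 : ℝ) < t := by exact_mod_cast ht
    simp only [Pi.div_apply]
    field_simp
  -- the counter
  obtain ⟨A, hA⟩ : ∃ A : ℕ → ℤ, ∀ t, A t = (digitCount v 0 (p t) : ℤ) - (n + 1) * digitCount v (k - 1) (p t) :=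
    ⟨_, fun t => rfl⟩
  have hArate : Tendsto (fun t => (A t : ℝ) / (t : ℝ)) atTop
      (𝓝 (proj α 0 / (1 - proj α 0) - (n + 1) * (proj α (k - 1) / (1 - proj α 0)))) := by
    refine ((hrate2 0 (by omega)).sub ((hrate2 (k - 1) (by omega)).const_mul ((n : ℝ) + 1))).congr ?_
    intro t
    rw [hA]
    push_cast
    ring
  have hδ : proj α 0 / (1 - proj α 0) - (n + 1) * (proj α (k - 1) / (1 - proj α 0)) < 0 := by
    rw [← mul_div_assoc, ← sub_div]
    apply div_neg_of_neg_of_pos _ hp1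
    linarith
  obtain ⟨G, hG1, hG2⟩ := exists_sup A _ hδ hArate
  have hGA : ∀ t, A t ≤ G t := fun t => by rw [hG1]; exact le_max_left _ _
  obtain ⟨c, hc⟩ : ∃ c : ℕ → ℕ, ∀ t, (c t : ℤ) = G t - A t :=
    ⟨fun t => (G t - A t).toNat, fun t => by have := hGA t; simp; omega⟩
  have hcrec : ∀ t, (c t : ℤ) = max 0 ((c (t + 1) : ℤ) + A (t + 1) - A t) := by
    intro t
    rw [hc, hc, hG1 t]
    omega
  have hA1 : ∀ t, d t + 1 < k → A (t + 1) - A t = z t := by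
    intro t ht
    rw [hA, hA, hcnt0, hcnt1 t (k - 1) (by omega), if_neg (by omega)]
    push_cast; ring
  have hA2 : ∀ t, d t + 1 = k → A (t + 1) - A t = (z t : ℤ) - n - 1 := by
    intro t ht
    rw [hA, hA, hcnt0, hcnt1 t (k - 1) (by omega), if_pos (by omega)]
    push_cast; ring
  have hcrate : Tendsto (fun t => (c t : ℝ) / (t : ℝ)) atTop (𝓝 0) := by
    have := hG2.sub hArate
    rw [sub_self] at this
    refine this.congr fun t => ?_
    have h1 : (c t : ℝ) = G t - A t := by exact_mod_cast hc t
    rw [h1]; ring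
  obtain ⟨u, hu⟩ : ∃ u : ℕ → ℕ, ∀ t, u t = if d t + 1 < k then d t - 1 else
      if z t = n ∧ c (t + 1) = 0 then k - 1 else k - 2 := ⟨_, fun t => rfl⟩
  have hdk : ∀ t, d t < k := fun t => by rw [hd]; exact hv _
  have T : Tok k n v u p d z c := by
    refine ⟨htok, hnz, hdk, fun t => (hd t).symm, fun t ht => ?_, fun t ht => ?_⟩
    · have h1 := hcrec t
      have h2 := hA1 t ht
      have h3 := hnz t
      rw [hu, if_pos ht]
      omega
    · have h1 := hcrec t
      have h2 := hA2 t ht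
      have h3 := hzn t ht
      have h4 := hu t
      rw [if_neg (by omega)] at h4
      split_ifs at h4 with h5
      · left
        omega
      · right
        refine ⟨h3, by omega, ?_⟩
        have : n + 1 ≤ c (t + 1) + z t := by omega
        omega
  have huk : ∀ t, u t < k := by
    intro t
    have := T.low t
    have := T.high t
    have := hdk t
    omega
  -- counts of u
  have hc1 : ∀ i, i + 2 < k → ∀ t, digitCount u i t + digitCount v (i + 1) (p 0) = digitCount v (i + 1) (p t) := by
    intro i hi t
    induction t with
    | zero => simp [dc_zero]
    | succ t ih =>
      have h1 := T.low t
      have h2 := T.high t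
      have h3 := hdk t
      rw [dc_succ, hcnt1 t _ (by omega), ← ih]
      split_ifs <;> omega
  have hc2 : ∀ t, digitCount u (k - 2) t + digitCount u (k - 1) t + digitCount v (k - 1) (p 0)
      = digitCount v (k - 1) (p t) := by
    intro t
    induction t with
    | zero => simp [dc_zero]
    | succ t ih =>
      have h1 := T.low t
      have h2 := T.high t
      have h3 := hdk t
      have h4 := hnz t
      rw [dc_succ, dc_succ, hcnt1 t _ (by omega), ← ih]
      split_ifs <;> omega
  have hc3 : ∀ t, digitCount v 0 (p t) + c t + n * digitCount v (k - 1) (p 0)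
      = digitCount v 0 (p 0) + n * digitCount v (k - 1) (p t) + digitCount u (k - 2) t + c 0 := by
    intro t
    induction t with
    | zero => simp [dc_zero]; ring
    | succ t ih =>
      have h1 := T.low t
      have h2 := T.high t
      have h3 := hdk t
      have h4 := hnz t
      rw [dc_succ, hcnt0, hcnt1 t (k - 1) (by omega), Nat.mul_add]
      by_cases h5 : d t = k - 1
      · rw [if_pos h5, mul_one]
        split_ifs <;> omega
      · rw [if_neg h5, mul_zero, if_neg (by omega)]
        omega
  have hconst : ∀ x : ℝ, Tendsto (fun t : ℕ => x / (t : ℝ)) atTop (𝓝 0) := fun x =>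
    tendsto_const_div_atTop_nhds_zero_nat x
  have hmid : Tendsto (fun r => (digitCount u (k - 2) r : ℝ) / (r : ℝ)) atTop (𝓝 (proj (Kstep α) (k - 2))) := by
    have h1 := (((hrate2 0 (by omega)).sub ((hrate2 (k - 1) (by omega)).const_mul (n : ℝ))).add hcrate).add
      (hconst (n * digitCount v (k - 1) (p 0) - digitCount v 0 (p 0) - c 0))
    have e : proj (Kstep α) (k - 2) =
        proj α 0 / (1 - proj α 0) - n * (proj α (k - 1) / (1 - proj α 0)) + 0 + 0 := by
      unfold Kstep
      rw [Kmap_mid hk, ← hn]; ring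
    rw [e]
    refine h1.congr fun t => ?_
    have h2 : (digitCount v 0 (p t) : ℝ) + c t + n * digitCount v (k - 1) (p 0)
      = digitCount v 0 (p 0) + n * digitCount v (k - 1) (p t) + digitCount u (k - 2) t + c 0 := by
      exact_mod_cast hc3 t
    have h3 : (digitCount u (k - 2) t : ℝ) = (digitCount v 0 (p t) : ℝ) + c t + n * digitCount v (k - 1) (p 0)
      - digitCount v 0 (p 0) - n * digitCount v (k - 1) (p t) - c 0 := by linarith
    rw [h3]; ring
  refine ⟨u, huk, ?_, ?_, ?_⟩
  · intro i hi
    rcases Nat.lt_trichotomy (i + 2) k with h | h | h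
    · unfold Kstep
      rw [Kmap_low _ _ _ h]
      have h1 := (hrate2 (i + 1) (by omega)).sub (hconst (digitCount v (i + 1) (p 0)))
      rw [sub_zero] at h1
      refine h1.congr fun t => ?_
      have h2 : (digitCount u i t : ℝ) + digitCount v (i + 1) (p 0) = digitCount v (i + 1) (p t) := by
        exact_mod_cast hc1 i h t
      rw [← h2]; ring
    · have : i = k - 2 := by omega
      subst this
      exact hmid
    · have : i = k - 1 := by omega
      subst this
      have h1 := ((hrate2 (k - 1) (by omega)).sub hmid).sub (hconst (digitCount v (k - 1) (p 0)))
      have e : proj (Kstep α) (k - 1) = proj α (k - 1) / (1 - proj α 0) - proj (Kstep α) (k - 2) - 0 := by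
        unfold Kstep
        rw [Kmap_mid hk, Kmap_top hk]; ring
      rw [e]
      refine h1.congr fun t => ?_
      have h2 : (digitCount u (k - 2) t : ℝ) + digitCount u (k - 1) t + digitCount v (k - 1) (p 0)
        = digitCount v (k - 1) (p t) := by exact_mod_cast hc2 t
      rw [← h2]; ring
  · intro t
    by_cases hut : u t + 1 = k
    · exact ltBy_mono (by omega) (tok_claim2 hk T L t s hsk hs0 hut (hL (p t)))
    · refine ⟨0, ltBy_pos (hL 0), fun j hj => by omega, ?_⟩
      rw [shift_iter, hs0]
      have := huk t
      simp; omega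
  · intro hn0 t
    by_cases hut : u t + 1 = k
    · exact ltBy_mono (by omega) (tok_claim2 hk T L t s hsk hs0 hut (hL (p t)))
    · refine ⟨0, ?_, fun j hj => by omega, ?_⟩
      · obtain ⟨r, _, hr⟩ := freq_pos_exists hf (by omega) hα2 0
        obtain ⟨q, h1, h2, h3⟩ := hL r
        rcases Nat.eq_zero_or_pos q with rfl | hq
        · rw [shift_iter, lamSub_zero k n hk s hs0] at h3
          simp at h3
          omega
        · omega
      · rw [shift_iter, hs0]
        have := huk t
        simp; omega

theorem full_freq {k : ℕ} {v : Seq} {α : E k} (hk : 2 ≤ k) (hf : HasDigitFreq k v α)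
    (h1 : proj α (k - 1) = 1) (L : ℕ) (hL : ∀ q, ltBy L (shift^[q] v) (topSeq k)) : False := by
  have hLp := ltBy_pos (hL 0)
  have hwin : ∀ q, digitCount (shift^[q] v) (k - 1) L + 1 ≤ L := by
    intro q
    obtain ⟨r, h2, _, h3⟩ := hL q
    unfold digitCount
    have : ((Finset.range L).filter fun s => (shift^[q] v) s = k - 1) ⊆ (Finset.range L).erase r := by
      intro x hx
      simp at hx ⊢
      refine ⟨?_, hx.1⟩
      rintro rfl
      rw [hx.2] at h3
      simp [topSeq] at h3
    have h4 := Finset.card_le_card this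
    rw [Finset.card_erase_of_mem (by simpa using h2), Finset.card_range] at h4
    omega
  have hN : ∀ N, digitCount v (k - 1) (N * L) + N ≤ N * L := by
    intro N
    induction N with
    | zero => simp [dc_zero]
    | succ N ih =>
      rw [Nat.succ_mul, dc_add]
      have := hwin (N * L)
      omega
  have h2 := hf (k - 1) (by omega)
  rw [h1] at h2
  have h3 : Tendsto (fun N : ℕ => N * L) atTop atTop :=
    tendsto_atTop_mono (fun N => Nat.le_mul_of_pos_right N (by omega)) tendsto_id
  have h4 := h2.comp h3
  have hLR : (0 : ℝ) < L := by exact_mod_cast hLp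
  have h5 : (1 : ℝ) ≤ 1 - 1 / L := by
    refine le_of_tendsto h4 ?_
    filter_upwards [eventually_ge_atTop 1] with N hN1
    have hNR : (0 : ℝ) < N := by exact_mod_cast hN1
    simp only [Function.comp]
    have h6 : (digitCount v (k - 1) (N * L) : ℝ) + N ≤ N * L := by exact_mod_cast hN N
    push_cast
    rw [div_le_iff₀ (by positivity)]
    have : (1 - 1 / (L : ℝ)) * (N * L) = N * L - N := by field_simp
    rw [this]; linarith
  have : 0 < 1 / (L : ℝ) := by positivity
  linarith

theorem no_small {k : ℕ} (hk : 2 ≤ k) (L : ℕ) : ∀ (α : E k), α ∈ simplex' k → ∀ v, InSigma k v →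
    HasDigitFreq k v α → (∀ q, ltBy L (shift^[q] v) (Sseq k (Phi α))) → False := by
  induction L with
  | zero => intro α _ v _ _ h; have := ltBy_pos (h 0); omega
  | succ L ih =>
    intro α hα v hv hf hL
    by_cases hz : ∀ r, Phi α r = 0
    · rw [Sseq_top k hk _ hz] at hL
      exact full_freq hk hf (zero_itin hk α hα hz).2 _ hL
    · push Not at hz
      obtain ⟨j, hj⟩ := hz
      induction j generalizing α v with
      | zero =>
        obtain ⟨u, h1, h2, _, h4⟩ := step hk hα hv hf _ hL
        exact ih _ (Kstep_mem hk hα) u h1 h2 (h4 hj)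
      | succ j ihj =>
        obtain ⟨u, h1, h2, h3, _⟩ := step hk hα hv hf _ hL
        exact ihj _ (Kstep_mem hk hα) u h1 h2 h3 (by rw [Phi_Kstep]; exact hj)

theorem baseSeq_le {k : ℕ} {w : Seq} (h0 : w 0 = k - 1) : seqLe (baseSeq k) w := by
  apply seqLe_of_not_lt
  rintro ⟨r, _, h⟩
  unfold baseSeq at h
  split_ifs at h with h1
  · subst h1; omega
  · omega

theorem forward {k : ℕ} (hk : 2 ≤ k) {w : Seq} (h0 : w 0 = k - 1) {α : E k} {v : Seq}
    (hv : v ∈ Xset k w) (hf : HasDigitFreq k v α) : seqLe (Ifun k α) w := by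
  unfold Ifun
  split_ifs with hα
  · apply seqLe_of_not_lt
    rintro ⟨r, h1, h2⟩
    refine no_small hk (r + 1) α hα v hv.1 hf fun q => ?_
    obtain ⟨q', h3, h4, h5⟩ := seqLt_of_le_of_lt (hv.2 q) ⟨r, h1, h2⟩ r h1 h2
    exact ⟨q', by omega, h4, h5⟩
  · exact baseSeq_le h0


theorem getD_prefix {l l' : List ℕ} (h : l <+: l') {m : ℕ} (hm : m < l.length) :
    l'.getD m 0 = l.getD m 0 := by
  obtain ⟨s, rfl⟩ := h
  rw [List.getD_append _ _ _ _ hm]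

theorem dc_mono (v : Seq) (i : ℕ) {r s : ℕ} (h : r ≤ s) : digitCount v i r ≤ digitCount v i s := by
  unfold digitCount
  apply Finset.card_le_card
  apply Finset.filter_subset_filter
  simpa using h

theorem concat_lemma (k : ℕ) (a : ℕ → ℝ) (ha0 : ∀ i, i < k → 0 ≤ a i) (ha1 : ∀ i, i < k → a i ≤ 1)
    (M : Set (List ℕ)) (hM : ∀ x ∈ M, ∀ y ∈ M, x ++ y ∈ M)
    (happ : ∀ ε : ℝ, 0 < ε → ∃ y ∈ M, y ≠ [] ∧
      ∀ i, i < k → |(y.count i : ℝ) - a i * y.length| ≤ ε * y.length) :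
    ∃ v : Seq, (∀ r, ∃ y ∈ M, (List.range r).map v <+: y) ∧
      ∀ i, i < k → Tendsto (fun r => (digitCount v i r : ℝ) / (r : ℝ)) atTop (𝓝 (a i)) := by
  choose Y hY1 hY2 hY3 using fun j : ℕ => happ (1 / ((j : ℝ) + 1)) (by positivity)
  obtain ⟨jj, hjj⟩ : ∃ jj : ℕ → ℕ, ∀ t, jj t =
      Nat.findGreatest (fun j => (Y j).length * (j + 1) ≤ t) t := ⟨_, fun t => rfl⟩
  obtain ⟨x, hx0, hxs⟩ : ∃ x : ℕ → List ℕ, x 0 = [] ∧ ∀ t, x (t + 1) = x t ++ Y (jj t) :=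
    ⟨fun t => Nat.rec [] (fun t l => l ++ Y (jj t)) t, rfl, fun t => rfl⟩
  have hYlen : ∀ j, 1 ≤ (Y j).length := fun j => List.length_pos_iff.2 (hY2 j)
  have hlen : ∀ t, (x (t + 1)).length = (x t).length + (Y (jj t)).length := fun t => by
    rw [hxs, List.length_append]
  have htlen : ∀ t, t ≤ (x t).length := by
    intro t
    induction t with
    | zero => omega
    | succ t ih => rw [hlen]; have := hYlen (jj t); omega
  have hpre : ∀ t t', t ≤ t' → x t <+: x t' := by
    intro t t' h
    induction t', h using Nat.le_induction with
    | base => exact List.prefix_rfl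
    | succ t' h ih => rw [hxs]; exact ih.trans (List.prefix_append _ _)
  have hxM : ∀ t, x (t + 1) ∈ M := by
    intro t
    induction t with
    | zero => rw [hxs, hx0]; exact hY1 _
    | succ t ih => rw [hxs]; exact hM _ ih _ (hY1 _)
  obtain ⟨v, hv⟩ : ∃ v : Seq, ∀ m, v m = (x (m + 1)).getD m 0 := ⟨_, fun m => rfl⟩
  have hv' : ∀ t m, m < (x t).length → v m = (x t).getD m 0 := by
    intro t m hm
    rw [hv]
    have h1 : m < (x (m + 1)).length := htlen (m + 1)
    rcases le_total t (m + 1) with h | h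
    · exact getD_prefix (hpre _ _ h) hm
    · exact (getD_prefix (hpre _ _ h) h1).symm
  have happ : ∀ t, v = app (x t) (shift^[(x t).length] v) := by
    intro t
    funext m
    unfold app
    split_ifs with h
    · exact hv' t m h
    · rw [shift_iter]; congr 1; omega
  have hdc : ∀ t i, digitCount v i (x t).length = (x t).count i := by
    intro t i
    conv_lhs => rw [happ t]
    exact dc_app _ _ _
  refine ⟨v, fun r => ⟨x (r + 1), hxM r, ?_⟩, ?_⟩
  · have : (List.range r).map v = (x (r + 1)).take r := by
      have hr := htlen (r + 1)
      apply List.ext_getElem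
      · simp; omega
      · intro m h1 h2
        simp at h1
        simp only [List.getElem_map, List.getElem_range, List.getElem_take]
        rw [hv' (r + 1) m (by omega), List.getD_eq_getElem _ _ (by omega)]
    rw [this]
    exact List.take_prefix _ _
  · intro i hi
    have ai0 := ha0 i hi
    have ai1 := ha1 i hi
    obtain ⟨f, hf⟩ : ∃ f : ℕ → ℝ, ∀ t, f t = ((x t).count i : ℝ) - a i * (x t).length := ⟨_, fun t => rfl⟩
    have hjinf : ∀ J, ∃ T, ∀ t, T ≤ t → J ≤ jj t := by
      intro J
      refine ⟨max J ((Y J).length * (J + 1)), fun t ht => ?_⟩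
      rw [hjj]
      exact Nat.le_findGreatest (le_trans (le_max_left _ _) ht) (le_trans (le_max_right _ _) ht)
    rw [Metric.tendsto_atTop]
    intro ε' hε'
    set ε := min (ε' / 5) 1 with hε
    have hε0 : 0 < ε := lt_min (by linarith) one_pos
    have hε1 : ε ≤ 1 := min_le_right _ _
    have hε5 : ε ≤ ε' / 5 := min_le_left _ _
    obtain ⟨J, hJ⟩ := exists_nat_gt (1 / ε)
    obtain ⟨T, hT⟩ := hjinf (J + 1)
    have hjε : ∀ t, T ≤ t → 1 / ((jj t : ℝ) + 1) ≤ ε := by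
      intro t ht
      have h1 : (J : ℝ) + 1 ≤ jj t := by exact_mod_cast hT t ht
      rw [div_le_iff₀ (by positivity)]
      rw [div_lt_iff₀ hε0] at hJ
      nlinarith
    have hYt : ∀ t, T ≤ t → ((Y (jj t)).length : ℝ) ≤ ε * t := by
      intro t ht
      have h1 := hT t ht
      have h2 : (Y (jj t)).length * (jj t + 1) ≤ t := by
        have h3 : jj t ≠ 0 := by omega
        have h4 := Nat.findGreatest_of_ne_zero (hjj t).symm h3
        exact h4
      have h3 : ((Y (jj t)).length : ℝ) * (jj t + 1) ≤ t := by exact_mod_cast h2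
      have h4 := hjε t ht
      rw [div_le_iff₀ (by positivity)] at h4
      have h5 : (0 : ℝ) ≤ (Y (jj t)).length := by positivity
      calc ((Y (jj t)).length : ℝ) = (Y (jj t)).length * 1 := by ring
        _ ≤ (Y (jj t)).length * (ε * (jj t + 1)) := by gcongr
        _ = ε * ((Y (jj t)).length * (jj t + 1)) := by ring
        _ ≤ ε * t := by gcongr
    have hfb : ∀ t, T ≤ t → |f t| ≤ |f T| + ε * (x t).length := by
      intro t ht
      induction t, ht using Nat.le_induction with
      | base =>
        have : 0 ≤ ε * ((x T).length : ℝ) := by positivity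
        linarith
      | succ t ht ih =>
        have h1 : f (t + 1) = f t + (((Y (jj t)).count i : ℝ) - a i * (Y (jj t)).length) := by
          rw [hf, hf, hxs, List.count_append, List.length_append]
          push_cast; ring
        have h2 := hY3 (jj t) i hi
        have h3 := hjε t ht
        have h4 : 1 / ((jj t : ℝ) + 1) * (Y (jj t)).length ≤ ε * (Y (jj t)).length := by gcongr
        rw [h1, hlen]
        push_cast
        have := abs_add_le (f t) (((Y (jj t)).count i : ℝ) - a i * (Y (jj t)).length)
        linarith
    obtain ⟨N, hN⟩ := exists_nat_gt (|f T| / ε)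
    refine ⟨max (max N (x T).length) 1, fun r hr => ?_⟩
    have hr1 : N ≤ r := le_trans (le_trans (le_max_left _ _) (le_max_left _ _)) hr
    have hr2 : (x T).length ≤ r := le_trans (le_trans (le_max_right _ _) (le_max_left _ _)) hr
    have hr3 : 1 ≤ r := le_trans (le_max_right _ _) hr
    have hex : ∃ t, r < (x t).length := ⟨r + 1, htlen (r + 1)⟩
    obtain ⟨t, ht1, ht2⟩ : ∃ t, (x t).length ≤ r ∧ r < (x (t + 1)).length := by
      have h1 := Nat.find_spec hex
      have h2 : Nat.find hex ≠ 0 := by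
        intro h
        rw [h, hx0] at h1
        simp at h1
      refine ⟨Nat.find hex - 1, ?_, ?_⟩
      · have := Nat.find_min hex (m := Nat.find hex - 1) (by omega)
        omega
      · rwa [Nat.sub_add_cancel (by omega)]
    have hTt : T ≤ t := by
      by_contra hc
      have := (hpre (t + 1) T (by omega)).length_le
      omega
    have hrR : (0 : ℝ) < r := by exact_mod_cast hr3
    have b1 : ((x t).count i : ℝ) ≤ digitCount v i r := by
      rw [← hdc]; exact_mod_cast dc_mono v i ht1
    have b2 : (digitCount v i r : ℝ) ≤ (x (t + 1)).count i := by
      rw [← hdc]; exact_mod_cast dc_mono v i ht2.le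
    have b3 := abs_le.1 (hfb t hTt)
    have b4 := abs_le.1 (hfb (t + 1) (by omega))
    rw [hf t] at b3
    rw [hf (t + 1)] at b4
    have b5 : ((x (t + 1)).length : ℝ) = (x t).length + (Y (jj t)).length := by exact_mod_cast hlen t
    have b6 := hYt t hTt
    have b7 : (t : ℝ) ≤ (x t).length := by exact_mod_cast htlen t
    have b8 : ((x t).length : ℝ) ≤ r := by exact_mod_cast ht1
    have b9 : (r : ℝ) ≤ (x (t + 1)).length := by exact_mod_cast ht2.le
    have b10 : |f T| < ε * r := by
      rw [div_lt_iff₀ hε0] at hN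
      have : (N : ℝ) ≤ r := by exact_mod_cast hr1
      nlinarith
    have b11 : ((Y (jj t)).length : ℝ) ≤ ε * r := b6.trans (by gcongr; exact (htlen t).trans ht1)
    have b12 : ε * ((x (t + 1)).length : ℝ) ≤ ε * r + ε * r := by
      rw [b5, mul_add]
      have h1 : ε * ((x t).length : ℝ) ≤ ε * r := by gcongr
      have h2 : ε * ((Y (jj t)).length : ℝ) ≤ 1 * (ε * r) := by gcongr
      linarith
    have b13 : ε * ((x t).length : ℝ) ≤ ε * r := by gcongr
    have b14 : a i * ((x (t + 1)).length : ℝ) ≤ a i * r + ε * r := by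
      have h1 : a i * ((x (t + 1)).length - r : ℝ) ≤ 1 * (ε * r) := by
        apply mul_le_mul ai1 (by linarith) (by linarith) (by norm_num)
      linarith
    have b15 : a i * r ≤ a i * ((x t).length : ℝ) + ε * r := by
      have h1 : a i * (r - (x t).length : ℝ) ≤ 1 * (ε * r) := by
        apply mul_le_mul ai1 (by linarith) (by linarith) (by norm_num)
      linarith
    rw [Real.dist_eq]
    have e : (digitCount v i r : ℝ) / r - a i = (digitCount v i r - a i * r) / r := by field_simp
    rw [e, abs_div, abs_of_pos hrR, div_lt_iff₀ hrR]
    have : 5 * (ε * r) ≤ ε' * r := by nlinarith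
    have hpos : 0 < ε * r := by positivity
    rw [abs_lt]
    constructor <;> linarith

theorem approx_all (k : ℕ) (a : ℕ → ℝ) (ha0 : ∀ i, i < k → 0 ≤ a i)
    (hsum : ∑ i ∈ Finset.range k, a i = 1) (ε : ℝ) (hε : 0 < ε) :
    ∃ y : List ℕ, (∀ d ∈ y, d < k ∧ a d ≠ 0) ∧ y ≠ [] ∧
      ∀ i, i < k → |(y.count i : ℝ) - a i * y.length| ≤ ε * y.length := by
  obtain ⟨N0, hN0⟩ := exists_nat_gt (((k : ℝ) + 1) / ε)
  obtain ⟨N, hN⟩ : ∃ N, N = k + N0 + 1 := ⟨_, rfl⟩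
  obtain ⟨y, hy⟩ : ∃ y, y = (List.range k).flatMap (fun i => List.replicate ⌊N * a i⌋₊ i) := ⟨_, rfl⟩
  have hcount : ∀ i, i < k → y.count i = ⌊N * a i⌋₊ := by
    have : ∀ k' i, ((List.range k').flatMap (fun i => List.replicate ⌊N * a i⌋₊ i)).count i
        = if i < k' then ⌊N * a i⌋₊ else 0 := by
      intro k' i
      induction k' with
      | zero => simp
      | succ k' ih =>
        rw [List.range_succ, List.flatMap_append, List.count_append, ih]
        simp only [List.flatMap_cons, List.flatMap_nil, List.append_nil, List.count_replicate]
        rcases Nat.lt_trichotomy i k' with h | h | h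
        · rw [if_pos h, if_neg (by simp; omega), if_pos (by omega)]; rfl
        · subst h; simp
        · rw [if_neg (by omega), if_neg (by simp; omega), if_neg (by omega)]
    intro i hi
    rw [hy, this, if_pos hi]
  have hlen : (y.length : ℝ) = ∑ i ∈ Finset.range k, (⌊N * a i⌋₊ : ℝ) := by
    have : ∀ k', (((List.range k').flatMap (fun i => List.replicate ⌊N * a i⌋₊ i)).length : ℝ)
        = ∑ i ∈ Finset.range k', (⌊N * a i⌋₊ : ℝ) := by
      intro k'
      induction k' with
      | zero => simp
      | succ k' ih =>
        rw [List.range_succ, List.flatMap_append, List.length_append, Nat.cast_add, ih, Finset.sum_range_succ]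
        simp
    rw [hy, this]
  have hNa : ∀ i, i < k → 0 ≤ N * a i := fun i hi => mul_nonneg (by positivity) (ha0 i hi)
  have hle : (y.length : ℝ) ≤ N := by
    rw [hlen]
    calc _ ≤ ∑ i ∈ Finset.range k, N * a i :=
          Finset.sum_le_sum fun i hi => Nat.floor_le (hNa i (by simpa using hi))
      _ = N := by rw [← Finset.mul_sum, hsum, mul_one]
  have hge : (N : ℝ) - k ≤ y.length := by
    rw [hlen]
    calc (N : ℝ) - k = ∑ i ∈ Finset.range k, (N * a i - 1) := by
          rw [Finset.sum_sub_distrib, ← Finset.mul_sum, hsum]; simp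
      _ ≤ _ := Finset.sum_le_sum fun i hi => by
          have := Nat.lt_floor_add_one (N * a i)
          linarith
  have hNR : (N : ℝ) = k + N0 + 1 := by rw [hN]; push_cast; ring
  have hpos : (N0 : ℝ) + 1 ≤ y.length := by linarith
  refine ⟨y, ?_, ?_, ?_⟩
  · intro d hd
    rw [hy] at hd
    simp only [List.mem_flatMap, List.mem_range, List.mem_replicate] at hd
    obtain ⟨i, h1, h2, rfl⟩ := hd
    refine ⟨h1, fun h => h2 ?_⟩
    rw [h]; simp
  · rintro h
    rw [h] at hpos
    simp at hpos
    have : (0 : ℝ) ≤ N0 := by positivity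
    linarith
  · intro i hi
    have h1 := Nat.floor_le (hNa i hi)
    have h2 := Nat.lt_floor_add_one (N * a i)
    have ai0 := ha0 i hi
    have ai1 : a i ≤ 1 := by
      rw [← hsum]
      exact Finset.single_le_sum (f := a) (fun j hj => ha0 j (by simpa using hj)) (by simpa using hi)
    rw [hcount i hi]
    have h3 : a i * y.length ≤ N * a i := by nlinarith
    have h4 : N * a i - k ≤ a i * y.length := by
      have : a i * (N - y.length) ≤ 1 * (k : ℝ) := by
        apply mul_le_mul ai1 (by linarith) (by linarith) (by norm_num)
      linarith
    have h5 : (k : ℝ) + 1 ≤ ε * y.length := by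
      rw [div_lt_iff₀ hε] at hN0
      nlinarith
    have hk0 : (0 : ℝ) ≤ k := by positivity
    rw [abs_le]
    constructor <;> linarith


theorem seqLe_of_listLe {v s : Seq} (h : ∀ m, listLe ((List.range m).map v) s) : seqLe v s := by
  apply seqLe_of_not_lt
  rintro ⟨r, h1, h2⟩
  have key : ∀ r (v s : Seq), (∀ t, t < r → s t = v t) → s r < v r →
      ¬ listLe ((List.range (r + 1)).map v) s := by
    intro r
    induction r with
    | zero =>
      intro v s _ h2 h3
      simp [listLe] at h3
      omega
    | succ r ih =>
      intro v s h1 h2 h3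
      rw [List.range_succ_eq_map, List.map_cons, List.map_map] at h3
      rcases h3 with h3 | ⟨_, h3⟩
      · have := h1 0 (by omega); omega
      · exact ih (shift v) (shift s) (fun t ht => h1 (t + 1) (by omega)) h2 h3
  exact key r v s h1 h2 (h _)

theorem closing {k : ℕ} {M : Set (List ℕ)} {s v : Seq} (hv : ∀ r, ∃ y ∈ M, (List.range r).map v <+: y)
    (hM : ∀ y ∈ M, (∀ d ∈ y, d < k) ∧ SG y s) : InSigma k v ∧ ∀ r, seqLe (shift^[r] v) s := by
  constructor
  · intro r
    obtain ⟨y, hy, hp⟩ := hv (r + 1)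
    apply (hM y hy).1
    apply hp.subset
    simp only [List.mem_map, List.mem_range]
    exact ⟨r, by omega, rfl⟩
  · intro r
    apply seqLe_of_listLe
    intro m
    obtain ⟨y, hy, t, ht⟩ := hv (r + m)
    have e : (List.range (r + m)).map v = (List.range r).map v ++ (List.range m).map (shift^[r] v) := by
      rw [List.range_add, List.map_append, List.map_map]
      congr 1
      apply List.map_congr_left
      intro x _
      rw [shift_iter]; rfl
    have hs := (hM y hy).2 ((List.range m).map (shift^[r] v) ++ t) ⟨(List.range r).map v, by
      rw [← List.append_assoc, ← e, ht]⟩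
    exact listLe_prefix hs

theorem lamL_append (k n : ℕ) (x y : List ℕ) : lamL k n (x ++ y) = lamL k n x ++ lamL k n y := by
  simp [lamL]

theorem lamL_cons (k n a : ℕ) (y : List ℕ) : lamL k n (a :: y) = lamWord k n a ++ lamL k n y := by
  simp [lamL]

theorem lamL_lt (k n : ℕ) (hk : 2 ≤ k) (y : List ℕ) : ∀ d ∈ lamL k n y, d < k := by
  intro d hd
  simp only [lamL, List.mem_flatMap] at hd
  obtain ⟨a, _, h⟩ := hd
  exact lamWord_lt k n a hk d h

theorem lamL_length_le (k n : ℕ) (y : List ℕ) : y.length ≤ (lamL k n y).length := by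
  induction y with
  | nil => simp
  | cons a y ih =>
    rw [lamL_cons, List.length_append, List.length_cons]
    have := lamWord_length_pos k n a
    omega

theorem lamL_counts (k n : ℕ) (hk : 2 ≤ k) (y : List ℕ) (hy : ∀ d ∈ y, d < k) :
    (lamL k n y).length = y.length + (n + 1) * y.count (k - 2) + n * y.count (k - 1) ∧
    (lamL k n y).count 0 = (n + 1) * y.count (k - 2) + n * y.count (k - 1) ∧
    (∀ i, i + 2 < k → (lamL k n y).count (i + 1) = y.count i) ∧
    (lamL k n y).count (k - 1) = y.count (k - 2) + y.count (k - 1) := by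
  induction y with
  | nil => simp [lamL]
  | cons a y ih =>
    obtain ⟨h1, h2, h3, h4⟩ := ih (fun d hd => hy d (List.mem_cons_of_mem _ hd))
    have ha := hy a List.mem_cons_self
    rw [lamL_cons]
    simp only [List.length_append, List.count_append, List.length_cons, h1, h2, h4]
    rcases lt_trichotomy (a + 2) k with h | h | h
    · rw [word_low h]
      have e1 : ¬ (a = k - 2) := by omega
      have e2 : ¬ (a = k - 1) := by omega
      have e3 : ¬ (a + 1 = k - 1) := by omega
      simp only [List.count_cons, List.count_nil, beq_iff_eq, List.length_cons, List.length_nil, e1, e2, e3, if_false]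
      refine ⟨by ring, by simp, ?_, by omega⟩
      intro i hi
      rw [h3 i hi]
      by_cases hh : a = i
      · simp [hh]; omega
      · simp [hh]
    · rw [word_mid h]
      have e1 : a = k - 2 := by omega
      have e2 : ¬ (k - 2 = k - 1) := by omega
      have e3 : k - 2 + 1 = k - 1 := by omega
      have e4 : ¬ (k - 1 = 0) := by omega
      have e5 : ¬ (0 = k - 1) := by omega
      subst e1
      simp only [List.count_cons, List.count_replicate, beq_iff_eq, List.length_cons, List.length_replicate, e2, e3, e4, e5, if_false, if_true]
      refine ⟨by ring, by ring, ?_, by omega⟩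
      intro i hi
      have e6 : ¬ (k - 1 = i + 1) := by omega
      have e7 : ¬ (k - 2 = i) := by omega
      have e8 : ¬ (0 = i + 1) := by omega
      simp only [e6, e7, e8, if_false, h3 i hi]; omega
    · have h' : a + 1 = k := by omega
      rw [word_high hk h']
      have e1 : a = k - 1 := by omega
      have e2 : ¬ (k - 1 = k - 2) := by omega
      have e4 : ¬ (k - 1 = 0) := by omega
      have e5 : ¬ (0 = k - 1) := by omega
      subst e1
      simp only [List.count_cons, List.count_replicate, beq_iff_eq, List.length_cons, List.length_replicate, e2, e4, e5, if_false, if_true]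
      refine ⟨by ring, by ring, ?_, by omega⟩
      intro i hi
      have e6 : ¬ (k - 1 = i + 1) := by omega
      have e7 : ¬ (k - 1 = i) := by omega
      have e8 : ¬ (0 = i + 1) := by omega
      simp only [e6, e7, e8, if_false, h3 i hi]; omega

/-- discrepancy bound -/
def disc {k : ℕ} (α : E k) (y : List ℕ) (ε : ℝ) : Prop :=
  ∀ i, i < k → |(y.count i : ℝ) - proj α i * y.length| ≤ ε * y.length

theorem transport {k : ℕ} (hk : 2 ≤ k) {α : E k} (hα : α ∈ simplex' k) (y : List ℕ)
    (hy : ∀ d ∈ y, d < k) (ε : ℝ) (hε : 0 ≤ ε) (h : disc (Kstep α) y ε) :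
    disc α (lamL k (Jfun α) y) ((2 * Jfun α + 3) * ε) := by
  obtain ⟨c1, c2, c3, c4⟩ := lamL_counts k (Jfun α) hk y hy
  obtain ⟨hs, hp⟩ := (mem_simplex'_iff hk α).1 hα
  have hq := one_sub_pos hk hα
  have hα0 := ((mem_simplex_iff α).1 hs).1
  have hα1 := proj_le_one hs
  have hmid := Kmap_mid hk (Jfun α) α
  have htop := Kmap_top hk (Jfun α) α
  have hlow := Kmap_low (Jfun α) α
  have hlen := lamL_length_le k (Jfun α) y
  generalize hn : Jfun α = n at *
  have hst : Kstep α = Kmap n α := by unfold Kstep; rw [hn]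
  rw [hst] at h
  generalize hΛ : lamL k n y = Y at *
  obtain ⟨ℓ, hℓ⟩ : ∃ ℓ : ℝ, ℓ = y.length := ⟨_, rfl⟩
  obtain ⟨L, hL⟩ : ∃ L : ℝ, L = Y.length := ⟨_, rfl⟩
  have hℓL : ℓ ≤ L := by rw [hℓ, hL]; exact_mod_cast hlen
  have hℓ0 : 0 ≤ ℓ := by rw [hℓ]; positivity
  obtain ⟨u, hu⟩ : ∃ u, u = ℓ / (1 - proj α 0) := ⟨_, rfl⟩
  have hu' : ℓ = (1 - proj α 0) * u := by rw [hu]; field_simp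
  unfold disc at h
  rw [← hℓ] at h
  have em := h (k - 2) (by omega)
  have et := h (k - 1) (by omega)
  rw [hmid, div_mul_eq_mul_div, mul_div_assoc, ← hu] at em
  rw [htop, div_mul_eq_mul_div, mul_div_assoc, ← hu] at et
  obtain ⟨x, hx⟩ : ∃ x : ℝ, x = (y.count (k - 2) : ℝ) - (proj α 0 - n * proj α (k - 1)) * u := ⟨_, rfl⟩
  obtain ⟨z, hz⟩ : ∃ z : ℝ, z = (y.count (k - 1) : ℝ) - ((n + 1) * proj α (k - 1) - proj α 0) * u := ⟨_, rfl⟩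
  rw [← hx] at em
  rw [← hz] at et
  have hx' : (y.count (k - 2) : ℝ) = x + (proj α 0 - n * proj α (k - 1)) * u := by rw [hx]; ring
  have hz' : (y.count (k - 1) : ℝ) = z + ((n + 1) * proj α (k - 1) - proj α 0) * u := by rw [hz]; ring
  obtain ⟨H, hH⟩ : ∃ H : ℝ, H = (n + 1) * x + n * z := ⟨_, rfl⟩
  have hn0 : (0 : ℝ) ≤ n := by positivity
  have hεℓ : 0 ≤ ε * ℓ := by positivity
  have hHb : |H| ≤ (2 * n + 1) * (ε * ℓ) := by
    rw [hH]
    calc |((n : ℝ) + 1) * x + n * z| ≤ |((n : ℝ) + 1) * x| + |n * z| := abs_add_le _ _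
      _ = (n + 1) * |x| + n * |z| := by rw [abs_mul, abs_mul, abs_of_nonneg hn0, abs_of_nonneg (by positivity : (0:ℝ) ≤ n + 1)]
      _ ≤ (n + 1) * (ε * ℓ) + n * (ε * ℓ) := by gcongr
      _ = _ := by ring
  have hLu : L = u + H := by
    rw [hL, c1]; push_cast
    rw [hx', hz', ← hℓ, hH, hu']; ring
  have hc : ∀ c : ℝ, 0 ≤ c → c ≤ 1 → |c * H| ≤ (2 * n + 1) * (ε * ℓ) := by
    intro c hc0 hc1
    rw [abs_mul, abs_of_nonneg hc0]
    nlinarith [abs_nonneg H]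
  have hfin : (2 * n + 3) * (ε * ℓ) ≤ (2 * n + 3) * ε * L := by
    rw [mul_assoc]; gcongr
  intro i hi
  rw [← hL]
  rcases Nat.eq_zero_or_pos i with rfl | hi0
  · have e : (Y.count 0 : ℝ) - proj α 0 * L = (1 - proj α 0) * H := by
      rw [c2, hLu]; push_cast; rw [hx', hz', hH]; ring
    rw [e]
    have := hc (1 - proj α 0) hq.le (by have := hα0 0 hi; linarith)
    linarith
  · by_cases hik : i = k - 1
    · subst hik
      have e : (Y.count (k - 1) : ℝ) - proj α (k - 1) * L = x + z - proj α (k - 1) * H := by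
        rw [c4, hLu]; push_cast; rw [hx', hz']; ring
      rw [e]
      have h1 := hc _ (hα0 _ hi) (hα1 _ hi)
      have h2 := abs_sub (x + z) (proj α (k - 1) * H)
      have h3 := abs_add_le x z
      linarith
    · obtain ⟨j, rfl⟩ : ∃ j, i = j + 1 := ⟨i - 1, by omega⟩
      have ej := h j (by omega)
      rw [hlow j (by omega), div_mul_eq_mul_div, mul_div_assoc, ← hu] at ej
      have e : (Y.count (j + 1) : ℝ) - proj α (j + 1) * L =
          ((y.count j : ℝ) - proj α (j + 1) * u) - proj α (j + 1) * H := by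
        rw [c3 j (by omega), hLu]; ring
      rw [e]
      have h1 := hc _ (hα0 _ hi) (hα1 _ hi)
      have h2 := abs_sub ((y.count j : ℝ) - proj α (j + 1) * u) (proj α (j + 1) * H)
      linarith

/-- iterated word substitution -/
def lamW (k : ℕ) : (ℕ → ℕ) → ℕ → List ℕ → List ℕ
  | _, 0, y => y
  | n, R + 1, y => lamL k (n 0) (lamW k (fun i => n (i + 1)) R y)

theorem lamW_append (k R : ℕ) : ∀ (n : ℕ → ℕ) (x y : List ℕ),
    lamW k n R (x ++ y) = lamW k n R x ++ lamW k n R y := by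
  induction R with
  | zero => intro n x y; rfl
  | succ R ih => intro n x y; simp only [lamW]; rw [ih, lamL_append]

theorem lamW_nil (k R : ℕ) : ∀ (n : ℕ → ℕ), lamW k n R [] = [] := by
  induction R with
  | zero => intro n; rfl
  | succ R ih => intro n; simp only [lamW]; rw [ih]; rfl

theorem lamW_flatMap (k R : ℕ) (n : ℕ → ℕ) (x : List ℕ) :
    lamW k n R x = x.flatMap (fun i => lamW k n R [i]) := by
  induction x with
  | nil => simp [lamW_nil]
  | cons a x ih =>
    rw [← List.singleton_append, lamW_append, ih]; simp

theorem lamW_lt (k R : ℕ) (hk : 2 ≤ k) : ∀ (n : ℕ → ℕ) (y : List ℕ), (∀ d ∈ y, d < k) →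
    ∀ d ∈ lamW k n R y, d < k := by
  cases R with
  | zero => intro n y hy; exact hy
  | succ R => intro n y hy; exact lamL_lt k _ hk _

theorem lamW_length_le (k R : ℕ) : ∀ (n : ℕ → ℕ) (y : List ℕ), y.length ≤ (lamW k n R y).length := by
  induction R with
  | zero => intro n y; exact le_rfl
  | succ R ih => intro n y; exact (ih _ y).trans (lamL_length_le _ _ _)

theorem lamW_add (k : ℕ) (b : ℕ) (y : List ℕ) (a : ℕ) : ∀ (n : ℕ → ℕ),
    lamW k n (a + b) y = lamW k n a (lamW k (fun i => n (a + i)) b y) := by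
  induction a with
  | zero => intro n; simp [lamW]
  | succ a ih =>
    intro n
    rw [show a + 1 + b = (a + b) + 1 by omega]
    simp only [lamW]
    rw [ih]
    simp only [show ∀ i, a + i + 1 = a + 1 + i by intro i; omega]

theorem lamW_SG (k R : ℕ) (hk : 2 ≤ k) : ∀ (α : E k) (y : List ℕ), SG y (Sseq k (Phi (Kstep^[R] α))) →
    SG (lamW k (Phi α) R y) (Sseq k (Phi α)) := by
  induction R with
  | zero => intro α y h; exact h
  | succ R ih =>
    intro α y h
    rw [I_eq hk]
    simp only [lamW]
    rw [← Phi_Kstep]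
    exact SG_lam k _ hk _ _ (Sseq_lt k hk _) (Sseq_zero k hk _) (ih (Kstep α) y h)

theorem lamW_disc (k R : ℕ) (hk : 2 ≤ k) : ∀ (α : E k), α ∈ simplex' k → ∃ C : ℝ, 0 < C ∧
    ∀ y : List ℕ, (∀ d ∈ y, d < k) → ∀ ε : ℝ, 0 ≤ ε → disc (Kstep^[R] α) y ε →
      disc α (lamW k (Phi α) R y) (C * ε) := by
  induction R with
  | zero => intro α h; exact ⟨1, one_pos, fun y hy ε hε h => by simpa [lamW] using h⟩
  | succ R ih =>
    intro α h
    obtain ⟨C, hC, hh⟩ := ih (Kstep α) (Kstep_mem hk h)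
    refine ⟨(2 * Jfun α + 3) * C, by positivity, fun y hy ε hε hd => ?_⟩
    simp only [lamW]
    rw [← Phi_Kstep, mul_assoc]
    exact transport hk h _ (lamW_lt k R hk _ y hy) _ (by positivity) (hh y hy ε hε hd)


theorem top_mem_lamWord {k n a : ℕ} (hk : 2 ≤ k) (h : k ≤ a + 2) : k - 1 ∈ lamWord k n a := by
  unfold lamWord
  rw [if_neg (by omega)]
  split_ifs <;> simp

theorem top_mem_lamL {k n : ℕ} (hk : 2 ≤ k) {y : List ℕ} (h : k - 1 ∈ y) : k - 1 ∈ lamL k n y := by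
  simp only [lamL, List.mem_flatMap]
  exact ⟨k - 1, h, top_mem_lamWord hk (by omega)⟩

theorem lamL_length_lt {k n : ℕ} (hk : 2 ≤ k) (hn : n ≠ 0) {y : List ℕ} (hy : ∀ d ∈ y, d < k) (h : k - 1 ∈ y) :
    y.length + 1 ≤ (lamL k n y).length := by
  have h1 := (lamL_counts k n hk y hy).1
  have h2 : 0 < y.count (k - 1) := List.count_pos_iff.2 h
  have h3 : 0 < n * y.count (k - 1) := Nat.mul_pos (by omega) h2
  omega

theorem lamW_step {k : ℕ} (hk : 2 ≤ k) (j : ℕ) : ∀ (n : ℕ → ℕ), n j ≠ 0 → ∀ z : List ℕ, (∀ d ∈ z, d < k) →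
    k - 1 ∈ z → z.length + 1 ≤ (lamW k n (j + 1) z).length ∧ k - 1 ∈ lamW k n (j + 1) z := by
  induction j with
  | zero =>
    intro n hn z hz h
    exact ⟨lamL_length_lt hk hn hz h, top_mem_lamL hk h⟩
  | succ j ih =>
    intro n hn z hz h
    obtain ⟨h1, h2⟩ := ih (fun i => n (i + 1)) hn z hz h
    exact ⟨h1.trans (lamL_length_le _ _ _), top_mem_lamL hk h2⟩

theorem lamW_top_or {k : ℕ} (hk : 2 ≤ k) (i : ℕ) (hi : i < k) (R : ℕ) : ∀ n : ℕ → ℕ,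
    k - 1 ∈ lamW k n R [i] ∨ (lamW k n R [i] = [i + R] ∧ i + R + 1 < k) := by
  induction R with
  | zero =>
    intro n
    by_cases h : i + 1 < k
    · right; exact ⟨rfl, h⟩
    · left; simp [lamW]; omega
  | succ R ih =>
    intro n
    rcases ih (fun i => n (i + 1)) with h | ⟨h, h'⟩
    · left; exact top_mem_lamL hk h
    · by_cases h2 : i + R + 2 < k
      · right
        refine ⟨?_, by omega⟩
        simp only [lamW]; rw [h]; simp [lamL, word_low h2]; omega
      · left
        simp only [lamW]; rw [h]; simp only [lamL, List.flatMap_cons, List.flatMap_nil, List.append_nil]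
        exact top_mem_lamWord hk (by omega)

theorem lamW_long {k : ℕ} (hk : 2 ≤ k) (B : ℕ) : ∀ n : ℕ → ℕ, (∀ N, ∃ j, N ≤ j ∧ n j ≠ 0) →
    ∃ R, ∀ i, i < k → B ≤ (lamW k n R [i]).length ∧ k - 1 ∈ lamW k n R [i] := by
  induction B with
  | zero =>
    intro n _
    refine ⟨k, fun i hi => ⟨Nat.zero_le _, ?_⟩⟩
    rcases lamW_top_or hk i hi k n with h | ⟨_, h⟩
    · exact h
    · omega
  | succ B ih =>
    intro n hn
    obtain ⟨j, _, hj⟩ := hn 0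
    obtain ⟨R, hR⟩ := ih (fun i => n (j + 1 + i)) (by
      intro N
      obtain ⟨t, ht, ht'⟩ := hn (j + 1 + N)
      refine ⟨t - (j + 1), by omega, ?_⟩
      show n (j + 1 + (t - (j + 1))) ≠ 0
      rwa [show j + 1 + (t - (j + 1)) = t by omega])
    refine ⟨j + 1 + R, fun i hi => ?_⟩
    obtain ⟨h1, h2⟩ := hR i hi
    rw [lamW_add]
    obtain ⟨h3, h4⟩ := lamW_step hk j n hj _ (lamW_lt k R hk _ [i] (by simpa using hi)) h2
    exact ⟨by omega, h4⟩

theorem zero_run (k n : ℕ) (hk : 2 ≤ k) (j : ℕ) : ∀ s : Seq, ∃ i, i < n + 2 ∧ lamSub k n s (j + i) ≠ 0 := by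
  induction j using Nat.strong_induction_on with
  | _ j ih =>
    intro s
    have hL : (lamWord k n (s 0)).length ≤ n + 2 := by
      unfold lamWord; split_ifs <;> simp
    have hL1 := lamWord_length_pos k n (s 0)
    rcases Nat.eq_zero_or_pos j with rfl | hj
    · exact ⟨0, by omega, by have := lamSub_zero_pos k n hk s; exact Nat.pos_iff_ne_zero.1 this⟩
    · by_cases h : j < (lamWord k n (s 0)).length
      · refine ⟨(lamWord k n (s 0)).length - j, by omega, ?_⟩
        rw [lamSub_eq]; unfold app
        rw [if_neg (by omega)]
        have := lamSub_zero_pos k n hk (shift s)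
        rw [show j + ((lamWord k n (s 0)).length - j) - (lamWord k n (s 0)).length = 0 by omega]
        omega
      · obtain ⟨i, hi, hi'⟩ := ih (j - (lamWord k n (s 0)).length) (by omega) (shift s)
        refine ⟨i, hi, ?_⟩
        rw [lamSub_eq]; unfold app
        rw [if_neg (by omega)]
        rwa [show j + i - (lamWord k n (s 0)).length = j - (lamWord k n (s 0)).length + i by omega]

theorem listLe_zeros (y : List ℕ) (m : ℕ) : ∀ s : Seq, (∃ i, i < m ∧ s i ≠ 0) →
    listLe (List.replicate m 0 ++ y) s := by
  induction m with
  | zero => rintro s ⟨i, hi, _⟩; omega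
  | succ m ih =>
    rintro s ⟨i, hi, h⟩
    rw [List.replicate_succ, List.cons_append]
    by_cases h0 : s 0 = 0
    · right
      refine ⟨h0.symm, ih _ ?_⟩
      cases i with
      | zero => omega
      | succ i => exact ⟨i, by omega, h⟩
    · left; omega

theorem listLe_pad (y : List ℕ) (m : ℕ) (g : List ℕ) : ∀ s : Seq, (∀ j, ∃ i, i < m ∧ s (j + i) ≠ 0) →
    listLe g s → listLe (g ++ (List.replicate m 0 ++ y)) s := by
  induction g with
  | nil =>
    intro s h _
    obtain ⟨i, hi, h'⟩ := h 0
    exact listLe_zeros y m s ⟨i, hi, by simpa using h'⟩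
  | cons a g ih =>
    intro s h hl
    rcases hl with hl | ⟨h1, h2⟩
    · exact Or.inl hl
    · refine Or.inr ⟨h1, ih _ (fun j => ?_) h2⟩
      obtain ⟨i, hi, h'⟩ := h (j + 1)
      exact ⟨i, hi, by unfold shift; rwa [show j + i + 1 = j + 1 + i by omega]⟩

theorem suffix_append_cases {z a b : List ℕ} (h : z <:+ a ++ b) :
    z <:+ b ∨ ∃ a', a' <:+ a ∧ z = a' ++ b := by
  obtain ⟨t, ht⟩ := h
  rw [List.append_eq_append_iff] at ht
  rcases ht with ⟨as, h1, h2⟩ | ⟨bs, h1, h2⟩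
  · right; exact ⟨as, ⟨t, h1.symm⟩, h2⟩
  · left; exact ⟨bs, h2.symm⟩

theorem SG_pad {s : Seq} (hs0 : s 0 ≠ 0) (m : ℕ) (hrun : ∀ j, ∃ i, i < m ∧ s (j + i) ≠ 0) (g y : List ℕ)
    (hg : SG g s) (hy : SG y s) : SG ((g ++ List.replicate m 0) ++ y) s := by
  intro z hz
  rw [List.append_assoc] at hz
  rcases suffix_append_cases hz with h | ⟨a, ha, rfl⟩
  · rcases suffix_append_cases h with h | ⟨a, ha, rfl⟩
    · exact hy z h
    · obtain ⟨c, rfl⟩ : ∃ c, a = List.replicate c 0 := by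
        refine ⟨a.length, ?_⟩
        rw [List.eq_replicate_iff]
        exact ⟨rfl, fun b hb => List.eq_of_mem_replicate (ha.subset hb)⟩
      cases c with
      | zero => exact hy _ (by simp)
      | succ c => left; simpa using Nat.pos_of_ne_zero hs0
  · exact listLe_pad y m a s hrun (hg a ha)

theorem pad_counts (f : ℕ → List ℕ) (m d : ℕ) (x : List ℕ) :
    (x.flatMap (fun i => f i ++ List.replicate m 0)).count d =
      (x.flatMap f).count d + (if d = 0 then m * x.length else 0) ∧
    (x.flatMap (fun i => f i ++ List.replicate m 0)).length = (x.flatMap f).length + m * x.length := by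
  induction x with
  | nil => simp
  | cons a x ih =>
    obtain ⟨h1, h2⟩ := ih
    simp only [List.flatMap_cons, List.count_append, List.length_append, List.length_cons, h1, h2,
      List.count_replicate, List.length_replicate, beq_iff_eq]
    constructor
    · by_cases hd : d = 0
      · simp [hd]; ring
      · simp [hd, Ne.symm hd]
    · ring

theorem flatMap_len (f : ℕ → List ℕ) (B : ℕ) (x : List ℕ) (h : ∀ i ∈ x, B ≤ (f i).length) :
    B * x.length ≤ (x.flatMap f).length := by
  induction x with
  | nil => simp
  | cons a x ih =>
    have h1 := ih (fun i hi => h i (List.mem_cons_of_mem _ hi))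
    have h2 := h a List.mem_cons_self
    simp only [List.flatMap_cons, List.length_append, List.length_cons]
    rw [mul_add]; omega

theorem finish {k : ℕ} {α : E k} (hα : α ∈ simplex k) {s w : Seq} (hsw : seqLe s w) (M : Set (List ℕ))
    (hM : ∀ x ∈ M, ∀ y ∈ M, x ++ y ∈ M) (hM2 : ∀ y ∈ M, (∀ d ∈ y, d < k) ∧ SG y s)
    (happ : ∀ ε : ℝ, 0 < ε → ∃ y ∈ M, y ≠ [] ∧ disc α y ε) :
    ∃ v ∈ Xset k w, HasDigitFreq k v α := by
  obtain ⟨v, h1, h2⟩ := concat_lemma k (proj α) ((mem_simplex_iff α).1 hα).1 (proj_le_one hα) M hM happ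
  obtain ⟨h3, h4⟩ := closing h1 hM2
  exact ⟨v, ⟨h3, fun r => seqLe_trans (h4 r) hsw⟩, h2⟩

theorem back_face {k : ℕ} (hk : 2 ≤ k) {α : E k} (hα : α ∈ simplex k) (hz : proj α (k - 1) = 0) {w : Seq}
    (h0 : w 0 = k - 1) : ∃ v ∈ Xset k w, HasDigitFreq k v α := by
  refine finish hα (s := w) (Or.inr rfl) {y | ∀ d ∈ y, d + 1 < k} ?_ ?_ ?_
  · intro x hx y hy d hd
    rcases List.mem_append.1 hd with h | h
    exacts [hx d h, hy d h]
  · intro y hy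
    refine ⟨fun d hd => by have := hy d hd; omega, fun z hzz => ?_⟩
    cases z with
    | nil => trivial
    | cons a z =>
      left
      have := hy a (hzz.subset List.mem_cons_self)
      omega
  · intro ε hε
    obtain ⟨h1, h2⟩ := (mem_simplex_iff α).1 hα
    obtain ⟨y, hy, hy1, hy2⟩ := approx_all k (proj α) h1 h2 ε hε
    refine ⟨y, fun d hd => ?_, hy1, hy2⟩
    obtain ⟨h3, h4⟩ := hy d hd
    by_contra hc
    exact h4 (by rw [show d = k - 1 by omega]; exact hz)

theorem lamW_ne_nil {k R : ℕ} {n : ℕ → ℕ} {y : List ℕ} (h : y ≠ []) : lamW k n R y ≠ [] := by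
  intro hc
  have := lamW_length_le k R n y
  rw [hc] at this
  exact h (List.length_eq_zero_iff.1 (by simpa using this))

theorem SG_top {k : ℕ} (hk : 2 ≤ k) {y : List ℕ} (hy : ∀ d ∈ y, d = k - 1) : SG y (topSeq k) := by
  intro z hz
  have hz' : ∀ d ∈ z, d = k - 1 := fun d hd => hy d (hz.subset hd)
  clear hz hy
  induction z with
  | nil => trivial
  | cons a z ih =>
    right
    exact ⟨hz' a List.mem_cons_self, ih (fun d hd => hz' d (List.mem_cons_of_mem _ hd))⟩

theorem back_rat {k : ℕ} (hk : 2 ≤ k) {α : E k} (hα : α ∈ simplex' k) (R : ℕ) (hz : ∀ j, R ≤ j → Phi α j = 0)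
    {w : Seq} (hw : seqLe (Sseq k (Phi α)) w) : ∃ v ∈ Xset k w, HasDigitFreq k v α := by
  have hβ := Kiter_mem hk hα R
  have hzz : ∀ r, Phi (Kstep^[R] α) r = 0 := by
    intro r; rw [Phi_Kiter]; exact hz _ (by omega)
  have hs := Sseq_top k hk _ hzz
  obtain ⟨hz1, _⟩ := zero_itin hk _ hβ hzz
  obtain ⟨C, hC, hCC⟩ := lamW_disc k R hk α hα
  refine finish ((mem_simplex'_iff hk α).1 hα).1 hw
    {Y | ∃ y : List ℕ, (∀ d ∈ y, d = k - 1) ∧ Y = lamW k (Phi α) R y} ?_ ?_ ?_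
  · rintro _ ⟨x, hx, rfl⟩ _ ⟨y, hy, rfl⟩
    refine ⟨x ++ y, fun d hd => ?_, (lamW_append _ _ _ _ _).symm⟩
    rcases List.mem_append.1 hd with h | h
    exacts [hx d h, hy d h]
  · rintro _ ⟨y, hy, rfl⟩
    refine ⟨lamW_lt k R hk _ y (fun d hd => by have := hy d hd; omega), lamW_SG k R hk α y ?_⟩
    rw [hs]; exact SG_top hk hy
  · intro ε hε
    obtain ⟨h1, h2⟩ := (mem_simplex_iff _).1 ((mem_simplex'_iff hk _).1 hβ).1
    obtain ⟨y, hy, hy1, hy2⟩ := approx_all k _ h1 h2 (ε / C) (by positivity)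
    refine ⟨_, ⟨y, fun d hd => ?_, rfl⟩, lamW_ne_nil hy1, ?_⟩
    · obtain ⟨h3, h4⟩ := hy d hd
      by_contra hc
      exact h4 (hz1 d (by omega))
    · have := hCC y (fun d hd => (hy d hd).1) (ε / C) (by positivity) hy2
      rwa [mul_div_cancel₀ _ hC.ne'] at this

theorem back_irr {k : ℕ} (hk : 2 ≤ k) {α : E k} (hα : α ∈ simplex' k)
    (hz : ∀ N, ∃ j, N ≤ j ∧ Phi α j ≠ 0)
    {w : Seq} (hw : seqLe (Sseq k (Phi α)) w) : ∃ v ∈ Xset k w, HasDigitFreq k v α := by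
  have hsimp := ((mem_simplex'_iff hk α).1 hα).1
  obtain ⟨s, hs⟩ : ∃ s, s = Sseq k (Phi α) := ⟨_, rfl⟩
  obtain ⟨m, hm⟩ : ∃ m, m = Jfun α + 2 := ⟨_, rfl⟩
  have hs0 : s 0 ≠ 0 := by rw [hs, Sseq_zero k hk]; omega
  have hrun : ∀ j, ∃ i, i < m ∧ s (j + i) ≠ 0 := by
    intro j; rw [hs, I_eq hk, hm]; exact zero_run k _ hk j _
  refine finish hsimp hw
    {y | (∀ d ∈ y, d < k) ∧ ∀ y', SG y' s → SG (y ++ y') s} ?_ ?_ ?_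
  · rintro x ⟨hx, hx'⟩ y ⟨hy, hy'⟩
    refine ⟨fun d hd => ?_, fun y' h => ?_⟩
    · rcases List.mem_append.1 hd with h | h
      exacts [hx d h, hy d h]
    · rw [List.append_assoc]; exact hx' _ (hy' _ h)
  · rintro y ⟨hy, hy'⟩
    refine ⟨hy, ?_⟩
    rw [← hs]
    have := hy' [] (fun z hzz => by rw [List.suffix_nil.1 hzz]; trivial)
    simpa using this
  · intro ε hε
    obtain ⟨B, hB⟩ := exists_nat_gt ((m : ℝ) / (ε / 2))
    rw [div_lt_iff₀ (by positivity)] at hB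
    obtain ⟨R, hR⟩ := lamW_long hk B (Phi α) hz
    obtain ⟨C, hC, hCC⟩ := lamW_disc k R hk α hα
    have hβ := Kiter_mem hk hα R
    obtain ⟨h1, h2⟩ := (mem_simplex_iff _).1 ((mem_simplex'_iff hk _).1 hβ).1
    obtain ⟨x, hx, hx1, hx2⟩ := approx_all k _ h1 h2 (ε / 2 / C) (by positivity)
    have hd := hCC x (fun d hd => (hx d hd).1) (ε / 2 / C) (by positivity) hx2
    rw [mul_div_cancel₀ _ hC.ne', lamW_flatMap] at hd
    have hlen := flatMap_len (fun i => lamW k (Phi α) R [i]) B x (fun i hi => (hR i (hx i hi).1).1)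
    have hpc := fun d => pad_counts (fun i => lamW k (Phi α) R [i]) m d x
    refine ⟨x.flatMap (fun i => lamW k (Phi α) R [i] ++ List.replicate m 0), ⟨?_, ?_⟩, ?_, ?_⟩
    · intro d hd
      obtain ⟨i, hi, hd⟩ := List.mem_flatMap.1 hd
      rcases List.mem_append.1 hd with h | h
      · exact lamW_lt k R hk _ [i] (by simpa using (hx i hi).1) d h
      · have := List.eq_of_mem_replicate h; omega
    · have hx' : ∀ d ∈ x, d < k := fun d hd => (hx d hd).1
      clear hx hx1 hx2 hd hlen hpc
      induction x with
      | nil => intro y' h; simpa using h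
      | cons a x ih =>
        intro y' h
        rw [List.flatMap_cons, List.append_assoc]
        refine SG_pad hs0 m hrun _ _ ?_ (ih (fun d hd => hx' d (List.mem_cons_of_mem _ hd)) y' h)
        rw [hs]
        apply lamW_SG k R hk
        intro z hzz
        cases z with
        | nil => trivial
        | cons b z =>
          have e1 := hzz.length_le
          have e2 : b = a := by simpa using hzz.subset List.mem_cons_self
          have e3 : z = [] := List.length_eq_zero_iff.1 (by simp at e1; simp [e1])
          subst e2 e3
          have := hx' b List.mem_cons_self
          have e4 := Sseq_zero k hk (Phi (Kstep^[R] α))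
          show _ ∨ (_ ∧ True)
          rw [e4]
          rcases Nat.lt_or_ge b (k - 1) with h5 | h5
          · exact Or.inl h5
          · exact Or.inr ⟨by omega, trivial⟩
    · intro hc
      have := (hpc 0).2
      rw [hc] at this
      have hl : 0 < x.length := List.length_pos_iff.2 hx1
      have h6 : 0 < m * x.length := Nat.mul_pos (by omega) hl
      rw [List.length_nil] at this
      omega
    · intro i hi
      have hdi := hd i hi
      have ha0 := ((mem_simplex_iff α).1 hsimp).1 i hi
      have ha1 := proj_le_one hsimp i hi
      rw [(hpc i).1, (hpc i).2]
      generalize (x.flatMap fun i => lamW k (Phi α) R [i]) = X at *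
      have hlen' : (B : ℝ) * x.length ≤ X.length := by exact_mod_cast hlen
      have hxl : (0 : ℝ) ≤ x.length := by positivity
      have hml : (m : ℝ) * x.length ≤ ε / 2 * X.length := by nlinarith
      obtain ⟨t, ht⟩ : ∃ t : ℝ, t = if i = 0 then 1 else 0 := ⟨_, rfl⟩
      have ht0 : 0 ≤ t := by rw [ht]; split_ifs <;> norm_num
      have ht1 : t ≤ 1 := by rw [ht]; split_ifs <;> norm_num
      have e : (((X.count i + if i = 0 then m * x.length else 0 : ℕ)) : ℝ) = X.count i + t * (m * x.length) := by
        rw [ht]; split_ifs <;> simp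
      rw [e]
      push_cast
      have hml0 : 0 ≤ (m : ℝ) * x.length := by positivity
      have e2 : |(t - proj α i) * (m * x.length)| ≤ m * x.length := by
        rw [abs_mul, abs_of_nonneg hml0]
        have : |t - proj α i| ≤ 1 := by rw [abs_le]; constructor <;> linarith
        nlinarith
      have e3 : (X.count i : ℝ) + t * (m * x.length) - proj α i * (X.length + m * x.length) =
        ((X.count i : ℝ) - proj α i * X.length) + (t - proj α i) * (m * x.length) := by ring
      rw [e3]
      have e4 := abs_add_le ((X.count i : ℝ) - proj α i * X.length) ((t - proj α i) * (m * x.length))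
      have : 0 ≤ ε * (m * x.length) := by positivity
      linarith

theorem main3 (k : ℕ) (hk : 2 ≤ k) (w : Seq)
    (h0 : w 0 = k - 1) :
    DFw k w = {α ∈ simplex k | seqLe (Ifun k α) w} := by
  ext α
  constructor
  · rintro ⟨hα, v, hv, hf⟩
    exact ⟨hα, forward hk h0 hv hf⟩
  · rintro ⟨hα, hI⟩
    refine ⟨hα, ?_⟩
    by_cases h : α ∈ simplex' k
    · unfold Ifun at hI
      rw [if_pos h] at hI
      by_cases hz : ∃ R, ∀ j, R ≤ j → Phi α j = 0
      · obtain ⟨R, hR⟩ := hz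
        exact back_rat hk h R hR hI
      · push Not at hz
        exact back_irr hk h hz hI
    · refine back_face hk hα ?_ h0
      by_contra hc
      exact h ⟨hα, fun hF => hc hF.2⟩

/-- `DF(w) = {α ∈ Δ : I(α) ≤ w}` for maximal `w` starting with `k−1`. -/
theorem stmt3 (k : ℕ) (hk : 2 ≤ k) (w : Seq) (hw : InSigma k w) (hmax : IsMaximal w)
    (h0 : w 0 = k - 1) :
    DFw k w = {α ∈ simplex k | seqLe (Ifun k α) w} := by
  exact main3 k hk w h0

end BetaDF
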